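/- Let f ∈ Homeo_{0,λ}(T²) with a lift f̃ such that ρ(f̃) has an extremal point of the form (p₁/q, p₂/q), where p₁, p₂, q are integers with q > 1 and gcd(p₁, p₂, q) = 1. Then the rotation set of f is not (2/√(πq))-upper-stable in Homeo_{0,λ}(T²): there exist an area-preserving g ∈ Homeo_{0,λ}(T²) and a lift g̃ of g with sup_{x∈ℝ²} ‖f̃(x) − g̃(x)‖ < 2/√(πq) and ρ(g̃) ⊄ ρ(f̃). -/

import Mathlib

noncomputable section

open Metric Set Filter Topology MeasureTheory Pointwise

/-- The plane `ℝ²` with the Euclidean metric. -/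
abbrev R2 : Type := EuclideanSpace ℝ (Fin 2)

/-- The integer lattice `ℤ² ⊂ ℝ²`. -/
def intLattice : AddSubgroup R2 where
  carrier := {v : R2 | ∀ i, ∃ n : ℤ, v i = (n : ℝ)}
  add_mem' := by
    intro a b ha hb i
    obtain ⟨m, hm⟩ := ha i
    obtain ⟨n, hn⟩ := hb i
    exact ⟨m + n, by push_cast; rw [← hm, ← hn]; rfl⟩
  zero_mem' := fun i => ⟨0, by simp⟩
  neg_mem' := by
    intro a ha i
    obtain ⟨m, hm⟩ := ha i
    exact ⟨-m, by push_cast; rw [← hm]; rfl⟩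

/-- The torus `T² = ℝ²/ℤ²`, with the quotient (Euclidean) metric. -/
abbrev T2 : Type := R2 ⧸ intLattice

/-- The covering projection `π : ℝ² → T²`. -/
def pr : R2 → T2 := QuotientAddGroup.mk

instance : MeasurableSpace T2 := borel T2
instance : BorelSpace T2 := ⟨rfl⟩

/-- A fundamental domain `[0,1)²` for the lattice action. -/
def fundDomain : Set R2 := {x : R2 | ∀ i, x i ∈ Set.Ico (0 : ℝ) 1}

/-- Lebesgue (Haar) probability measure on the torus `T²`. -/
def lebT2 : Measure T2 := Measure.map pr (volume.restrict fundDomain)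

/-- `F : ℝ² → ℝ²` is a lift of `f : T² → T²` if `π ∘ F = f ∘ π` and
`F (x + w) = F x + w` for every lattice vector `w ∈ ℤ²`. -/
structure IsLift (f : T2 ≃ₜ T2) (F : R2 ≃ₜ R2) : Prop where
  proj : ∀ x : R2, pr (F x) = f (pr x)
  equivariant : ∀ x : R2, ∀ w ∈ intLattice, F (x + w) = F x + w

/-- `Homeo₀(T²)`: homeomorphisms of the torus isotopic to the identity,
characterized as those admitting a lift commuting with integer translations. -/
def Homeo0 : Set (T2 ≃ₜ T2) := {f | ∃ F : R2 ≃ₜ R2, IsLift f F}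

/-- `Homeo_{0,λ}(T²)`: elements of `Homeo₀(T²)` preserving Lebesgue measure. -/
def Homeo0Leb : Set (T2 ≃ₜ T2) :=
  {f | f ∈ Homeo0 ∧ MeasurePreserving f lebT2 lebT2}

/-- The uniform `C⁰` distance `d_{C⁰}(f,g) = sup_x d(f(x), g(x))` on torus maps. -/
def dC0 (f g : T2 ≃ₜ T2) : ℝ := ⨆ x : T2, dist (f x) (g x)

/-- The uniform distance `sup_{x ∈ ℝ²} ‖F(x) − G(x)‖` between maps of the plane. -/
def supDist (F G : R2 → R2) : ℝ := ⨆ x : R2, dist (F x) (G x)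

/-- The rotation set `ρ(F̃)` of a lift: all limits `(F̃^{n_k}(z_k) − z_k)/n_k`. -/
def rotSet (F : R2 ≃ₜ R2) : Set R2 :=
  {v | ∃ (z : ℕ → R2) (n : ℕ → ℕ), Tendsto n atTop atTop ∧
    Tendsto (fun k => (n k : ℝ)⁻¹ • ((⇑F)^[n k] (z k) - z k)) atTop (𝓝 v)}

/-- The rotation set of `f`, with fixed lift `F`, is `δ`-upper-stable in `H`. -/
def UpperStable (H : Set (T2 ≃ₜ T2)) (F : R2 ≃ₜ R2) (δ : ℝ) : Prop :=
  ∀ g ∈ H, ∀ G : R2 ≃ₜ R2, IsLift g G → supDist (⇑F) (⇑G) < δ →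
    rotSet G ⊆ rotSet F

/-- The rotation set of `f`, with fixed lift `F`, is `δ`-stable in `H`. -/
def StableRS (H : Set (T2 ≃ₜ T2)) (F : R2 ≃ₜ R2) (δ : ℝ) : Prop :=
  ∀ g ∈ H, ∀ G : R2 ≃ₜ R2, IsLift g G → supDist (⇑F) (⇑G) < δ →
    rotSet G = rotSet F

/-- `f` has a stable rotation set in `H`. -/
def HasStableRotSet (H : Set (T2 ≃ₜ T2)) (f : T2 ≃ₜ T2) : Prop :=
  ∃ F : R2 ≃ₜ R2, IsLift f F ∧ ∃ δ > 0, StableRS H F δ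

/-- `S` is open in `H` for the uniform `C⁰` topology. -/
def OpenIn (H S : Set (T2 ≃ₜ T2)) : Prop :=
  ∀ f ∈ S ∩ H, ∃ δ > 0, ∀ g ∈ H, dC0 f g < δ → g ∈ S

/-- `S` is dense in `H` for the uniform `C⁰` topology. -/
def DenseIn (H S : Set (T2 ≃ₜ T2)) : Prop :=
  ∀ f ∈ H, ∀ ε > 0, ∃ g ∈ S ∩ H, dC0 f g < ε

/-- `(x_i)_{0 ≤ i ≤ n}` is a finite `ε`-pseudo-orbit of `F`. -/
def IsPseudoOrbitUpTo (F : R2 → R2) (ε : ℝ) (x : ℕ → R2) (n : ℕ) : Prop :=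
  ∀ i < n, dist (F (x i)) (x (i + 1)) < ε

/-- `(x_i)_{i ∈ ℕ}` is an infinite `ε`-pseudo-orbit of `F`. -/
def IsPseudoOrbit (F : R2 → R2) (ε : ℝ) (x : ℕ → R2) : Prop :=
  ∀ i : ℕ, dist (F (x i)) (x (i + 1)) < ε

/-- The `ε`-pseudo-rotation set `ρ_ε(F̃)`. -/
def pseudoRotSet (F : R2 → R2) (ε : ℝ) : Set R2 :=
  {v | ∃ (n : ℕ → ℕ) (x : ℕ → ℕ → R2), Tendsto n atTop atTop ∧
    (∀ k, IsPseudoOrbitUpTo F ε (x k) (n k)) ∧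
    Tendsto (fun k => (n k : ℝ)⁻¹ • (x k (n k) - x k 0)) atTop (𝓝 v)}

/-- The oscillation `osc(f) = sup_{x,y} ‖(F(x) − x) − (F(y) − y)‖` of a lift. -/
def osc (F : R2 → R2) : ℝ := ⨆ p : R2 × R2, ‖(F p.1 - p.1) - (F p.2 - p.2)‖

/-- `f` has the shadowing property. -/
def Shadowing (f : T2 ≃ₜ T2) : Prop :=
  ∀ ε > 0, ∃ δ > 0, ∀ x : ℕ → T2, (∀ i, dist (f (x i)) (x (i + 1)) < δ) →
    ∃ z : T2, ∀ i, dist ((⇑f)^[i] z) (x i) < ε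

/-- `v ∈ ℚ² ⊂ ℝ²`. -/
def IsRationalPoint (v : R2) : Prop := ∀ i, ∃ q : ℚ, v i = (q : ℝ)



/-- lattice vector from integer coordinates -/
def lat (a : Fin 2 → ℤ) : R2 := WithLp.toLp 2 (fun i => (a i : ℝ))

@[simp] lemma lat_apply (a : Fin 2 → ℤ) (i : Fin 2) : lat a i = (a i : ℝ) := rfl

lemma lat_mem (a : Fin 2 → ℤ) : lat a ∈ intLattice := fun i => ⟨a i, rfl⟩

lemma exists_lat {w : R2} (hw : w ∈ intLattice) : ∃ a, w = lat a := by
  choose a ha using hw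
  exact ⟨a, by ext i; simp [ha]⟩

lemma lat_add (a b : Fin 2 → ℤ) : lat (a + b) = lat a + lat b := by
  ext i; simp

lemma lat_neg (a : Fin 2 → ℤ) : lat (-a) = -lat a := by
  ext i; simp

instance lat_countable : Countable intLattice := by
  have : Function.Surjective (fun a : Fin 2 → ℤ => (⟨lat a, lat_mem a⟩ : intLattice)) := by
    rintro ⟨w, hw⟩
    obtain ⟨a, rfl⟩ := exists_lat hw
    exact ⟨a, rfl⟩
  exact this.countable

lemma abs_coord_le (x : R2) (i : Fin 2) : |x i| ≤ ‖x‖ := by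
  simpa using PiLp.norm_apply_le x i

lemma one_le_norm_lat {w : R2} (hw : w ∈ intLattice) (h0 : w ≠ 0) : 1 ≤ ‖w‖ := by
  obtain ⟨a, rfl⟩ := exists_lat hw
  have : ∃ i, a i ≠ 0 := by
    by_contra! h
    apply h0
    ext i; simp [h]
  obtain ⟨i, hi⟩ := this
  refine le_trans ?_ (abs_coord_le _ i)
  rw [lat_apply]
  rw [← Int.cast_abs]
  exact_mod_cast Int.one_le_abs hi

lemma normsq (x : R2) : ‖x‖ ^ 2 = x 0 ^ 2 + x 1 ^ 2 := by
  rw [EuclideanSpace.norm_sq_eq]; simp [Fin.sum_univ_two]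

lemma pr_eq_iff {x y : R2} : pr x = pr y ↔ ∃ k ∈ intLattice, y = x + k := by
  unfold pr
  rw [QuotientAddGroup.eq]
  constructor
  · intro h; exact ⟨_, h, by abel⟩
  · rintro ⟨k, hk, rfl⟩; simpa using hk

lemma pr_add {x k : R2} (hk : k ∈ intLattice) : pr (x + k) = pr x :=
  (pr_eq_iff.2 ⟨k, hk, rfl⟩).symm

lemma pr_surj : Function.Surjective pr := QuotientAddGroup.mk_surjective

lemma pr_cont : Continuous pr := continuous_quotient_mk'

lemma pr_open : IsOpenMap pr := QuotientAddGroup.isOpenMap_coe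

/-- unit box with lower corner `b` -/
def box (b : R2) : Set R2 := {x : R2 | ∀ i, x i - b i ∈ Set.Ico (0 : ℝ) 1}

lemma box_zero : box 0 = fundDomain := by
  ext x; simp [box, fundDomain]

lemma box_meas (b : R2) : MeasurableSet (box b) := by
  have : box b = ⋂ i : Fin 2, (fun x : R2 => x i - b i) ⁻¹' (Set.Ico (0 : ℝ) 1) := by
    ext x; simp [box]
  rw [this]
  refine MeasurableSet.iInter fun i => ?_
  exact measurableSet_Ico.preimage (by fun_prop)

lemma box_fund (b : R2) : IsAddFundamentalDomain intLattice (box b) (volume : Measure R2) := by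
  refine IsAddFundamentalDomain.mk' (box_meas b).nullMeasurableSet fun x => ?_
  refine ⟨⟨lat (fun i => - ⌊x i - b i⌋), lat_mem _⟩, ?_, ?_⟩
  · intro i
    have : ((⟨lat (fun i => - ⌊x i - b i⌋), lat_mem _⟩ : intLattice) +ᵥ x) i = - ⌊x i - b i⌋ + x i := by
      change (lat (fun i => - ⌊x i - b i⌋) + x) i = _
      simp
    rw [this]
    constructor
    · linarith [Int.floor_le (x i - b i)]
    · linarith [Int.lt_floor_add_one (x i - b i)]
  · rintro ⟨w, hw⟩ h
    obtain ⟨a, rfl⟩ := exists_lat hw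
    congr 1
    congr 1
    ext i
    have h1 := h i
    have : ((⟨lat a, hw⟩ : intLattice) +ᵥ x) i = a i + x i := by
      change (lat a + x) i = _
      simp
    rw [this] at h1
    have : ⌊x i - b i⌋ = - a i := by
      rw [Int.floor_eq_iff]
      push_cast
      constructor <;> linarith [h1.1, h1.2]
    omega

lemma pr_meas : Measurable pr := pr_cont.measurable

lemma preim_inv (A : Set T2) (g : intLattice) : (g +ᵥ · : R2 → R2) ⁻¹' (pr ⁻¹' A) = pr ⁻¹' A := by
  ext x
  simp only [mem_preimage]
  have : pr (g +ᵥ x) = pr x := by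
    change pr ((g : R2) + x) = pr x
    rw [add_comm]; exact pr_add g.2
  rw [this]

lemma leb_apply (b : R2) {A : Set T2} (hA : MeasurableSet A) :
    lebT2 A = volume (pr ⁻¹' A ∩ box b) := by
  unfold lebT2
  rw [Measure.map_apply pr_meas hA, Measure.restrict_apply (pr_meas hA), ← box_zero]
  exact (box_fund 0).measure_set_eq (box_fund b) (pr_meas hA) (preim_inv A)

lemma vol_box (b : R2) : volume (box b) = 1 := by
  have h := (box_fund b).measure_eq (box_fund 0)
  rw [h]
  have : box 0 = (@WithLp.ofLp 2 (Fin 2 → ℝ)) ⁻¹' (Set.pi Set.univ fun _ => Set.Ico (0:ℝ) 1) := by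
    ext x; simp [box]
  rw [this, (PiLp.volume_preserving_ofLp (Fin 2)).measure_preimage
    (MeasurableSet.univ_pi fun _ => measurableSet_Ico).nullMeasurableSet]
  rw [Real.volume_pi_Ico]; simp

instance leb_prob : IsProbabilityMeasure lebT2 := ⟨by
  rw [leb_apply 0 MeasurableSet.univ]; simp [vol_box]⟩

lemma leb_pos {O : Set R2} (hO : IsOpen O) (hne : O.Nonempty) : lebT2 (pr '' O) ≠ 0 := by
  intro h
  rw [leb_apply 0 (pr_open O hO).measurableSet] at h
  have h2 := (box_fund 0).measure_zero_of_invariant (pr ⁻¹' (pr '' O)) (by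
    intro g
    ext x
    rw [Set.mem_vadd_set_iff_neg_vadd_mem]
    exact Set.ext_iff.1 (preim_inv (pr '' O) (-g)) x) h
  exact (hO.measure_pos volume hne).ne' (measure_mono_null (subset_preimage_image pr O) h2)

/-- Admissible plane homeomorphisms: lifts of area preserving torus homeomorphisms. -/
def Adm (H : R2 ≃ₜ R2) : Prop := ∃ h : T2 ≃ₜ T2, IsLift h H ∧ MeasurePreserving h lebT2 lebT2

lemma Adm.equiv {H : R2 ≃ₜ R2} (h : Adm H) (x : R2) {w : R2} (hw : w ∈ intLattice) :
    H (x + w) = H x + w := h.choose_spec.1.equivariant x w hw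

lemma Adm.refl : Adm (Homeomorph.refl R2) :=
  ⟨Homeomorph.refl T2, ⟨fun _ => rfl, fun _ _ _ => rfl⟩, MeasurePreserving.id _⟩

lemma Adm.trans {H K : R2 ≃ₜ R2} (h : Adm H) (k : Adm K) : Adm (H.trans K) := by
  obtain ⟨h, h1, h2⟩ := h
  obtain ⟨k, k1, k2⟩ := k
  refine ⟨h.trans k, ⟨fun x => ?_, fun x w hw => ?_⟩, k2.comp h2⟩
  · simp [k1.proj, h1.proj]
  · simp [h1.equivariant x w hw, k1.equivariant _ w hw]

lemma equiv_symm (H : R2 ≃ₜ R2) (h : ∀ x, ∀ w ∈ intLattice, H (x + w) = H x + w) :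
    ∀ x, ∀ w ∈ intLattice, H.symm (x + w) = H.symm x + w := by
  intro x w hw
  rw [Homeomorph.symm_apply_eq, h _ _ hw]; simp

/-- descend -/
lemma exists_descend (H : R2 ≃ₜ R2) (h : ∀ x, ∀ w ∈ intLattice, H (x + w) = H x + w) :
    ∃ g : T2 ≃ₜ T2, IsLift g H := by
  have key : ∀ K : R2 ≃ₜ R2, (∀ x, ∀ w ∈ intLattice, K (x + w) = K x + w) →
      ∃ g : T2 → T2, Continuous g ∧ ∀ x, g (pr x) = pr (K x) := by
    intro K hK
    have hw : ∀ a b : R2, (QuotientAddGroup.leftRel intLattice) a b → pr (K a) = pr (K b) := by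
      intro a b hab
      rw [QuotientAddGroup.leftRel_apply] at hab
      have : b = a + (-a + b) := by abel
      rw [this, hK _ _ hab, pr_add hab]
    refine ⟨Quotient.lift (fun x => pr (K x)) hw, ?_, fun x => rfl⟩
    exact (pr_cont.comp K.continuous).quotient_lift hw
  obtain ⟨g, gc, hg⟩ := key H h
  obtain ⟨k, kc, hk⟩ := key H.symm (equiv_symm H h)
  refine ⟨{ toFun := g, invFun := k, left_inv := ?_, right_inv := ?_,
            continuous_toFun := gc, continuous_invFun := kc }, ⟨?_, h⟩⟩
  · intro x; obtain ⟨x, rfl⟩ := pr_surj x; rw [hg, hk]; simp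
  · intro x; obtain ⟨x, rfl⟩ := pr_surj x; rw [hk, hg]; simp
  · intro x; exact (hg x).symm

/-- criterion -/
lemma adm_of_box (H : R2 ≃ₜ R2) (h : ∀ x, ∀ w ∈ intLattice, H (x + w) = H x + w) (b : R2)
    (hv : ∀ s, MeasurableSet s → s ⊆ box b → volume (H ⁻¹' s) = volume s)
    (hb : H ⁻¹' (box b) = box b) : Adm H := by
  obtain ⟨g, hg⟩ := exists_descend H h
  refine ⟨g, hg, g.continuous.measurable, ?_⟩
  ext A hA
  rw [Measure.map_apply g.continuous.measurable hA, leb_apply b (g.continuous.measurable hA),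
    leb_apply b hA, ← hv _ ((pr_meas hA).inter (box_meas b)) inter_subset_right, preimage_inter, hb]
  congr 2
  ext x
  simp [hg.proj]


/-- C¹ cutoff angle -/
def ang (κ R s : ℝ) : ℝ := κ * (max 0 (R ^ 2 - s)) ^ 2

lemma hasDerivAt_maxsq (s : ℝ) : HasDerivAt (fun s : ℝ => (max 0 s) ^ 2) (2 * max 0 s) s := by
  rcases lt_trichotomy s 0 with h | h | h
  · rw [max_eq_left h.le]
    have : (fun s : ℝ => (max 0 s) ^ 2) =ᶠ[𝓝 s] fun _ => 0 := by
      filter_upwards [Iio_mem_nhds h] with y hy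
      rw [max_eq_left (le_of_lt hy)]; simp
    simpa using (hasDerivAt_const s (0:ℝ)).congr_of_eventuallyEq this
  · subst h
    rw [hasDerivAt_iff_isLittleO]
    simp only [max_self, mul_zero, smul_zero, sub_zero]
    have h1 : (fun x : ℝ => (max 0 x)^2 - 0 ^ 2) =O[𝓝 0] fun x : ℝ => x ^ 2 := by
      refine Asymptotics.IsBigO.of_bound 1 (Eventually.of_forall fun x => ?_)
      simp only [ne_eq, OfNat.ofNat_ne_zero, not_false_eq_true, zero_pow, sub_zero, norm_pow, Real.norm_eq_abs, one_mul]
      rcases le_total x 0 with hx | hx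
      · rw [max_eq_left hx]; simp; positivity
      · rw [max_eq_right hx]
    refine h1.trans_isLittleO ?_
    simpa using Asymptotics.isLittleO_pow_pow (𝕜 := ℝ) (m := 1) (n := 2) (by norm_num)
  · rw [max_eq_right h.le]
    have : (fun s : ℝ => (max 0 s) ^ 2) =ᶠ[𝓝 s] fun s => s ^ 2 := by
      filter_upwards [Ioi_mem_nhds h] with y hy
      rw [max_eq_right (le_of_lt hy)]
    simpa using (hasDerivAt_pow 2 s).congr_of_eventuallyEq this

lemma hasDerivAt_ang (κ R s : ℝ) : HasDerivAt (ang κ R) (-(κ * (2 * max 0 (R ^ 2 - s)))) s := by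
  have h := ((hasDerivAt_maxsq (R ^ 2 - s)).comp s ((hasDerivAt_id s).const_sub (R ^ 2))).const_mul κ
  exact HasDerivAt.congr_deriv (f := ang κ R) h (by simp)

/-- twist map around `m` -/
def tw (κ R : ℝ) (m x : R2) : R2 :=
  !₂[m 0 + (Real.cos (ang κ R ((x 0 - m 0) ^ 2 + (x 1 - m 1) ^ 2)) * (x 0 - m 0)
        - Real.sin (ang κ R ((x 0 - m 0) ^ 2 + (x 1 - m 1) ^ 2)) * (x 1 - m 1)),
    m 1 + (Real.sin (ang κ R ((x 0 - m 0) ^ 2 + (x 1 - m 1) ^ 2)) * (x 0 - m 0)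
        + Real.cos (ang κ R ((x 0 - m 0) ^ 2 + (x 1 - m 1) ^ 2)) * (x 1 - m 1))]

/-- linear map of a 2x2 matrix -/
def linm (a b c d : ℝ) : R2 →L[ℝ] R2 :=
  LinearMap.toContinuousLinearMap
    { toFun := fun v => !₂[a * v 0 + b * v 1, c * v 0 + d * v 1]
      map_add' := by intro x y; ext i; fin_cases i <;> simp <;> ring
      map_smul' := by intro r y; ext i; fin_cases i <;> simp <;> ring }

lemma linm_apply (a b c d : ℝ) (v : R2) : linm a b c d v = !₂[a * v 0 + b * v 1, c * v 0 + d * v 1] := rfl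

lemma linm_det (a b c d : ℝ) : (linm a b c d).det = a * d - b * c := by
  rw [ContinuousLinearMap.det, ← LinearMap.det_toMatrix (EuclideanSpace.basisFun (Fin 2) ℝ).toBasis,
    Matrix.det_fin_two]
  simp [LinearMap.toMatrix_apply, linm]

lemma tw_hasFDerivAt (κ R : ℝ) (m x : R2) : ∃ f' : R2 →L[ℝ] R2, HasFDerivAt (tw κ R m) f' x ∧ f'.det = 1 := by
  set a := x 0 - m 0 with ha
  set b := x 1 - m 1 with hb
  set θ := ang κ R (a ^ 2 + b ^ 2) with hθ
  set t := -(κ * (2 * max 0 (R ^ 2 - (a ^ 2 + b ^ 2)))) with ht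
  set C := Real.cos θ with hC
  set S := Real.sin θ with hS
  have h0 : HasFDerivAt (fun x : R2 => x 0 - m 0) (PiLp.proj 2 (fun _ : Fin 2 => ℝ) 0 : R2 →L[ℝ] ℝ) x :=
    (PiLp.proj 2 (fun _ : Fin 2 => ℝ) 0 : R2 →L[ℝ] ℝ).hasFDerivAt.sub_const (m 0)
  have h1 : HasFDerivAt (fun x : R2 => x 1 - m 1) (PiLp.proj 2 (fun _ : Fin 2 => ℝ) 1 : R2 →L[ℝ] ℝ) x :=
    (PiLp.proj 2 (fun _ : Fin 2 => ℝ) 1 : R2 →L[ℝ] ℝ).hasFDerivAt.sub_const (m 1)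
  have hs := (h0.pow 2).add (h1.pow 2)
  have hang := (hasDerivAt_ang κ R (a ^ 2 + b ^ 2)).comp_hasFDerivAt x hs
  have hcos := hang.cos
  have hsin := hang.sin
  refine ⟨linm (C - S * (t * (2 * a)) * a - C * (t * (2 * a)) * b)
      (-S - S * (t * (2 * b)) * a - C * (t * (2 * b)) * b)
      (S + C * (t * (2 * a)) * a - S * (t * (2 * a)) * b)
      (C + C * (t * (2 * b)) * a - S * (t * (2 * b)) * b), ?_, ?_⟩
  · rw [← hasFDerivWithinAt_univ, hasFDerivWithinAt_euclidean]
    simp only [hasFDerivWithinAt_univ]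
    intro i
    fin_cases i
    · have := ((hcos.mul h0).sub (hsin.mul h1)).const_add (m 0)
      refine HasFDerivAt.congr_fderiv this ?_
      ext v
      simp [linm_apply, ← ha, ← hb, ← ht, ← hθ, ← hC, ← hS]
      ring
    · have := ((hsin.mul h0).add (hcos.mul h1)).const_add (m 1)
      refine HasFDerivAt.congr_fderiv this ?_
      ext v
      simp [linm_apply, ← ha, ← hb, ← ht, ← hθ, ← hC, ← hS]
      ring
  · rw [linm_det]
    have : S ^ 2 + C ^ 2 = 1 := Real.sin_sq_add_cos_sq θ
    linear_combination this


lemma tw0 (κ R : ℝ) (m x : R2) : tw κ R m x 0 - m 0 =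
    Real.cos (ang κ R ((x 0 - m 0) ^ 2 + (x 1 - m 1) ^ 2)) * (x 0 - m 0)
        - Real.sin (ang κ R ((x 0 - m 0) ^ 2 + (x 1 - m 1) ^ 2)) * (x 1 - m 1) := by
  simp [tw]
lemma tw1 (κ R : ℝ) (m x : R2) : tw κ R m x 1 - m 1 =
    Real.sin (ang κ R ((x 0 - m 0) ^ 2 + (x 1 - m 1) ^ 2)) * (x 0 - m 0)
        + Real.cos (ang κ R ((x 0 - m 0) ^ 2 + (x 1 - m 1) ^ 2)) * (x 1 - m 1) := by
  simp [tw]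

lemma tw_sq (κ R : ℝ) (m x : R2) : (tw κ R m x 0 - m 0) ^ 2 + (tw κ R m x 1 - m 1) ^ 2 =
    (x 0 - m 0) ^ 2 + (x 1 - m 1) ^ 2 := by
  rw [tw0, tw1]
  set θ := ang κ R ((x 0 - m 0) ^ 2 + (x 1 - m 1) ^ 2)
  linear_combination ((x 0 - m 0) ^ 2 + (x 1 - m 1) ^ 2) * Real.sin_sq_add_cos_sq θ

lemma tw_norm (κ R : ℝ) (m x : R2) : ‖tw κ R m x - m‖ = ‖x - m‖ := by
  rw [← sq_eq_sq₀ (norm_nonneg _) (norm_nonneg _), normsq, normsq]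
  exact tw_sq κ R m x

lemma R2_ext {x y : R2} (h0 : x 0 = y 0) (h1 : x 1 = y 1) : x = y := by
  ext i; fin_cases i <;> assumption

lemma tw_inv (κ R : ℝ) (m x : R2) : tw (-κ) R m (tw κ R m x) = x := by
  have hn : ∀ s, ang (-κ) R s = - ang κ R s := fun s => by unfold ang; ring
  have e0 := tw0 (-κ) R m (tw κ R m x)
  have e1 := tw1 (-κ) R m (tw κ R m x)
  rw [tw_sq, hn, Real.cos_neg, Real.sin_neg] at e0 e1
  have a0 := tw0 κ R m x
  have a1 := tw1 κ R m x
  rw [a0, a1] at e0 e1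
  set θ := ang κ R ((x 0 - m 0) ^ 2 + (x 1 - m 1) ^ 2)
  have := Real.sin_sq_add_cos_sq θ
  apply R2_ext
  · linear_combination e0 + (x 0 - m 0) * this
  · linear_combination e1 + (x 1 - m 1) * this

lemma tw_id (κ R : ℝ) (hR : 0 ≤ R) (m x : R2) (h : R ≤ ‖x - m‖) : tw κ R m x = x := by
  have h2 : R ^ 2 ≤ (x 0 - m 0) ^ 2 + (x 1 - m 1) ^ 2 := by
    have := normsq (x - m)
    simp only [PiLp.sub_apply] at this
    rw [← this]; gcongr
  have hθ : ang κ R ((x 0 - m 0) ^ 2 + (x 1 - m 1) ^ 2) = 0 := by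
    unfold ang; rw [max_eq_left (by linarith)]; ring
  have e0 := tw0 κ R m x
  have e1 := tw1 κ R m x
  rw [hθ] at e0 e1
  simp only [Real.cos_zero, Real.sin_zero] at e0 e1
  apply R2_ext <;> linarith

lemma tw_swap {R : ℝ} {m y : R2} (h : ‖y - m‖ < R) :
    ∃ κ, tw κ R m y = m + m - y ∧ tw κ R m (m + m - y) = y := by
  have hn := normsq (y - m)
  simp only [PiLp.sub_apply] at hn
  have hpos : 0 < R ^ 2 - ((y 0 - m 0) ^ 2 + (y 1 - m 1) ^ 2) := by
    rw [← hn]; nlinarith [norm_nonneg (y - m)]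
  have hang : ang (Real.pi / (R ^ 2 - ((y 0 - m 0) ^ 2 + (y 1 - m 1) ^ 2)) ^ 2) R
      ((y 0 - m 0) ^ 2 + (y 1 - m 1) ^ 2) = Real.pi := by
    unfold ang
    rw [max_eq_right hpos.le]
    field_simp
  refine ⟨Real.pi / (R ^ 2 - ((y 0 - m 0) ^ 2 + (y 1 - m 1) ^ 2)) ^ 2, ?_, ?_⟩
  · have e0 := tw0 (Real.pi / (R ^ 2 - ((y 0 - m 0) ^ 2 + (y 1 - m 1) ^ 2)) ^ 2) R m y
    have e1 := tw1 (Real.pi / (R ^ 2 - ((y 0 - m 0) ^ 2 + (y 1 - m 1) ^ 2)) ^ 2) R m y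
    rw [hang] at e0 e1
    simp only [Real.cos_pi, Real.sin_pi] at e0 e1
    apply R2_ext <;> simp only [PiLp.sub_apply, PiLp.add_apply] <;> linarith
  · have e0 := tw0 (Real.pi / (R ^ 2 - ((y 0 - m 0) ^ 2 + (y 1 - m 1) ^ 2)) ^ 2) R m (m + m - y)
    have e1 := tw1 (Real.pi / (R ^ 2 - ((y 0 - m 0) ^ 2 + (y 1 - m 1) ^ 2)) ^ 2) R m (m + m - y)
    have hh : ((m + m - y) 0 - m 0) ^ 2 + ((m + m - y) 1 - m 1) ^ 2 = (y 0 - m 0) ^ 2 + (y 1 - m 1) ^ 2 := by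
      simp only [PiLp.sub_apply, PiLp.add_apply]; ring
    rw [hh, hang] at e0 e1
    simp only [Real.cos_pi, Real.sin_pi, PiLp.sub_apply, PiLp.add_apply] at e0 e1
    apply R2_ext <;> linarith

lemma tw_cont (κ R : ℝ) (m : R2) : Continuous (tw κ R m) :=
  continuous_iff_continuousAt.2 fun x => (tw_hasFDerivAt κ R m x).choose_spec.1.continuousAt

lemma tw_vol (κ R : ℝ) (m : R2) {s : Set R2} (hs : MeasurableSet s) :
    volume (tw κ R m ⁻¹' s) = volume s := by
  have hinj : Function.Injective (tw (-κ) R m) := by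
    intro x y h
    rw [← tw_inv (-κ) R m x, ← tw_inv (-κ) R m y, h]
  have hpre : tw κ R m ⁻¹' s = tw (-κ) R m '' s := by
    ext x; constructor
    · intro h; exact ⟨_, h, tw_inv κ R m x⟩
    · rintro ⟨y, hy, rfl⟩
      have := tw_inv (-κ) R m y
      rw [neg_neg] at this
      rw [mem_preimage, this]; exact hy
  choose f' hf' hdet using tw_hasFDerivAt (-κ) R m
  rw [hpre, ← lintegral_abs_det_fderiv_eq_addHaar_image volume hs
    (fun x _ => (hf' x).hasFDerivWithinAt) hinj.injOn]
  simp [hdet]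

/-- rounding to nearest lattice vector -/
def rd (u : R2) : Fin 2 → ℤ := fun i => round (u i)

lemma rd_closest (u : R2) {k : R2} (hk : k ∈ intLattice) : ‖u - lat (rd u)‖ ≤ ‖u - k‖ := by
  obtain ⟨a, rfl⟩ := exists_lat hk
  rw [← sq_le_sq₀ (norm_nonneg _) (norm_nonneg _), normsq, normsq]
  simp only [PiLp.sub_apply, lat_apply, rd]
  have h0 := sq_le_sq.2 (round_le (u 0) (a 0))
  have h1 := sq_le_sq.2 (round_le (u 1) (a 1))
  linarith

lemma rd_add_lat (u : R2) (a : Fin 2 → ℤ) : rd (u + lat a) = rd u + a := by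
  ext i; simp [rd]

lemma rd_small {u : R2} (h : ‖u‖ < 1 / 2) : rd u = 0 := by
  ext i
  have := (abs_coord_le u i).trans_lt h
  rw [abs_lt] at this
  simp only [rd, Pi.zero_apply, round_eq_zero_iff]
  constructor <;> linarith

/-- equivariant twist -/
def etw (κ R : ℝ) (m x : R2) : R2 := tw κ R m (x - lat (rd (x - m))) + lat (rd (x - m))

lemma etw_equiv (κ R : ℝ) (m x : R2) {w : R2} (hw : w ∈ intLattice) :
    etw κ R m (x + w) = etw κ R m x + w := by
  obtain ⟨a, rfl⟩ := exists_lat hw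
  unfold etw
  have : x + lat a - m = (x - m) + lat a := by abel
  rw [this, rd_add_lat, lat_add, add_sub_add_right_eq_sub]
  abel

lemma etw_eq_id (κ R : ℝ) (hR : 0 ≤ R) (m x : R2) (h : ∀ k ∈ intLattice, R ≤ ‖x - k - m‖) :
    etw κ R m x = x := by
  unfold etw
  rw [tw_id κ R hR m _ (h _ (lat_mem _))]; abel

lemma etw_eq_tw (κ : ℝ) {R : ℝ} (m x : R2) (h : ‖x - m‖ < 1 / 2) :
    etw κ R m x = tw κ R m x := by
  unfold etw; rw [rd_small h]
  have : lat 0 = 0 := by ext i; simp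
  simp [this]

lemma etw_inv (κ : ℝ) {R : ℝ} (hR0 : 0 ≤ R) (hR : R < 1 / 2) (m x : R2) :
    etw (-κ) R m (etw κ R m x) = x := by
  rcases lt_or_ge ‖x - lat (rd (x - m)) - m‖ R with h | h
  · conv_lhs => rw [← sub_add_cancel x (lat (rd (x - m)))]
    rw [etw_equiv _ _ _ _ (lat_mem _), etw_equiv _ _ _ _ (lat_mem _), etw_eq_tw κ m (x - lat (rd (x - m))) (by linarith),
      etw_eq_tw (-κ) m _ (by rw [tw_norm]; linarith), tw_inv]
    abel
  · have key : ∀ k ∈ intLattice, R ≤ ‖x - k - m‖ := by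
      intro k hk
      have := rd_closest (x - m) hk
      rw [sub_right_comm] at h ⊢
      linarith
    rw [etw_eq_id κ R hR0 m x key, etw_eq_id (-κ) R hR0 m x key]

lemma etw_cont (κ : ℝ) {R : ℝ} (hR0 : 0 ≤ R) (hR : R < 1 / 2) (m : R2) : Continuous (etw κ R m) := by
  rw [continuous_iff_continuousAt]
  intro x
  rcases lt_or_ge ‖x - lat (rd (x - m)) - m‖ (1 / 2) with h | h
  · set k := lat (rd (x - m)) with hk
    have hev : etw κ R m =ᶠ[𝓝 x] fun y => tw κ R m (y - k) + k := by
      have : {y : R2 | ‖y - k - m‖ < 1 / 2} ∈ 𝓝 x :=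
        (isOpen_lt (by fun_prop) continuous_const).mem_nhds h
      filter_upwards [this] with y hy
      conv_lhs => rw [← sub_add_cancel y k]
      rw [etw_equiv _ _ _ _ (lat_mem _), etw_eq_tw _ _ _ hy]
    refine ContinuousAt.congr ?_ hev.symm
    exact (((tw_cont κ R m).comp (continuous_id.sub continuous_const)).add continuous_const).continuousAt
  · have hev : etw κ R m =ᶠ[𝓝 x] fun y => y := by
      filter_upwards [Metric.ball_mem_nhds x (show 0 < 1 / 2 - R by linarith)] with y hy
      apply etw_eq_id κ R hR0
      intro k hk
      have h1 := rd_closest (x - m) hk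
      rw [sub_right_comm] at h ⊢
      rw [mem_ball, dist_comm, dist_eq_norm] at hy
      have h2 : ‖x - m - k‖ ≤ ‖x - y‖ + ‖y - m - k‖ := by
        have : x - m - k = (x - y) + (y - m - k) := by abel
        rw [this]; exact norm_add_le _ _
      linarith
    exact continuousAt_id.congr hev.symm

/-- the equivariant twist homeomorphism -/
def etwH (κ R : ℝ) (hR0 : 0 ≤ R) (hR : R < 1 / 2) (m : R2) : R2 ≃ₜ R2 where
  toFun := etw κ R m
  invFun := etw (-κ) R m
  left_inv := etw_inv κ hR0 hR m
  right_inv := fun x => by simpa using etw_inv (-κ) hR0 hR m x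
  continuous_toFun := etw_cont κ hR0 hR m
  continuous_invFun := etw_cont (-κ) hR0 hR m

lemma etw_adm (κ R : ℝ) (hR0 : 0 ≤ R) (hR : R < 1 / 2) (m : R2) : Adm (etwH κ R hR0 hR m) := by
  set b : R2 := m - WithLp.toLp 2 (fun _ => (1 / 2 : ℝ)) with hbdef
  have hbox : ∀ x, x ∈ box b ↔ rd (x - m) = 0 := by
    intro x
    simp only [box, Set.mem_ofPred_eq, hbdef, funext_iff, rd, Pi.zero_apply, round_eq_zero_iff,
      PiLp.sub_apply, mem_Ico]
    refine forall_congr' fun i => ?_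
    constructor <;> rintro ⟨h1, h2⟩ <;> constructor <;> linarith
  have hbox' : ∀ κ x, x ∈ box b → etw κ R m x = tw κ R m x := by
    intro κ x hx
    rw [hbox] at hx
    unfold etw
    rw [hx]
    have : lat 0 = 0 := by ext i; simp
    simp [this]
  have htw : ∀ κ x, x ∈ box b → tw κ R m x ∈ box b := by
    intro κ x hx
    rcases lt_or_ge ‖x - m‖ R with h | h
    · rw [hbox]; apply rd_small; rw [tw_norm]; linarith
    · rwa [tw_id κ R hR0 m x h]
  have htw' : ∀ κ x, tw κ R m x ∈ box b → x ∈ box b := by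
    intro κ x hx
    rw [← tw_inv κ R m x]
    exact htw _ _ hx
  have hetw : ∀ κ x, x ∈ box b → etw κ R m x ∈ box b := by
    intro κ x hx; rw [hbox' κ x hx]; exact htw κ x hx
  have hb : etw κ R m ⁻¹' (box b) = box b := by
    ext x
    constructor
    · intro h
      rw [← etw_inv κ hR0 hR m x]; exact hetw _ _ h
    · exact hetw κ x
  refine adm_of_box _ (fun x w hw => etw_equiv κ R m x hw) b ?_ hb
  intro s hs hsb
  rw [← tw_vol κ R m hs]
  congr 1
  ext x
  change etw κ R m x ∈ s ↔ tw κ R m x ∈ s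
  constructor
  · intro h
    have : x ∈ box b := by rw [← hb]; exact hsb h
    rwa [← hbox' κ x this]
  · intro h
    have : x ∈ box b := htw' κ x (hsb h)
    rwa [hbox' κ x this]

/-- Swap lemma -/
lemma exists_swapH {R : ℝ} (hR : R < 1 / 2) {m y : R2} (h : ‖y - m‖ < R) :
    ∃ H : R2 ≃ₜ R2, Adm H ∧ H y = m + m - y ∧ H (m + m - y) = y ∧
      (∀ x, (∀ k ∈ intLattice, R ≤ ‖x - k - m‖) → H x = x) ∧
      (∀ x, ‖x - m‖ < R → ‖H x - m‖ < R) ∧ ∀ x, ‖H x - x‖ ≤ 2 * R := by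
  have hR0 : 0 ≤ R := (norm_nonneg _).trans h.le
  obtain ⟨κ, h1, h2⟩ := tw_swap h
  have hball : ∀ x, ‖x - m‖ < R → ‖etw κ R m x - m‖ < R := by
    intro x hx
    rw [etw_eq_tw κ m x (by linarith), tw_norm]; exact hx
  refine ⟨etwH κ R hR0 hR m, etw_adm κ R hR0 hR m, ?_, ?_, ?_, hball, ?_⟩
  · change etw κ R m y = _
    rw [etw_eq_tw κ m y (by linarith), h1]
  · change etw κ R m _ = _
    rw [etw_eq_tw κ m _ ?_, h2]
    have : m + m - y - m = -(y - m) := by abel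
    rw [this, norm_neg]; linarith
  · intro x hx; exact etw_eq_id κ R hR0 m x hx
  · intro x
    change ‖etw κ R m x - x‖ ≤ _
    by_cases hx : ∀ k ∈ intLattice, R ≤ ‖x - k - m‖
    · rw [etw_eq_id κ R hR0 m x hx]; simpa using hR0
    · push Not at hx
      obtain ⟨k, hk, hx⟩ := hx
      have h3 := hball _ hx
      have h4 := etw_equiv κ R m (x - k) hk
      rw [sub_add_cancel] at h4
      rw [h4]
      have : etw κ R m (x - k) + k - x = (etw κ R m (x - k) - m) - (x - k - m) := by abel
      rw [this]
      refine (norm_sub_le _ _).trans ?_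
      linarith


lemma rotSet_iff (G : R2 ≃ₜ R2) (v : R2) : v ∈ rotSet G ↔
    ∀ ε > 0, ∀ N : ℕ, ∃ n ≥ N, ∃ z : R2, ‖(n : ℝ)⁻¹ • ((⇑G)^[n] z - z) - v‖ < ε := by
  constructor
  · rintro ⟨z, n, hn, hl⟩ ε hε N
    have h1 := (Metric.tendsto_nhds.1 hl) ε hε
    obtain ⟨k, hk1, hk2⟩ := (h1.and (hn.eventually_ge_atTop N)).exists
    exact ⟨n k, hk2, z k, by rwa [dist_eq_norm] at hk1⟩
  · intro h
    choose n hn z hz using fun k : ℕ => h (1 / ((k : ℝ) + 1)) (by positivity) k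
    refine ⟨z, n, tendsto_atTop_mono hn tendsto_id, ?_⟩
    rw [tendsto_iff_norm_sub_tendsto_zero]
    exact squeeze_zero (fun _ => norm_nonneg _) (fun k => (hz k).le) tendsto_one_div_add_atTop_nhds_zero_nat

lemma rotSet_closed (G : R2 ≃ₜ R2) : IsClosed (rotSet G) := by
  rw [← closure_subset_iff_isClosed]
  intro v hv
  rw [rotSet_iff]
  intro ε hε N
  obtain ⟨u, hu, huv⟩ := Metric.mem_closure_iff.1 hv (ε / 2) (by linarith)
  obtain ⟨n, hn, z, hz⟩ := (rotSet_iff G u).1 hu (ε / 2) (by linarith) N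
  refine ⟨n, hn, z, ?_⟩
  rw [dist_comm, dist_eq_norm] at huv
  have : (n : ℝ)⁻¹ • ((⇑G)^[n] z - z) - v = ((n : ℝ)⁻¹ • ((⇑G)^[n] z - z) - u) + (u - v) := by abel
  rw [this]
  refine (norm_add_le _ _).trans_lt ?_
  linarith

lemma iter_equiv {G : R2 → R2} (hG : ∀ x, ∀ w ∈ intLattice, G (x + w) = G x + w) (n : ℕ) :
    ∀ x, ∀ w ∈ intLattice, G^[n] (x + w) = G^[n] x + w := by
  induction n with
  | zero => intro x w _; rfl
  | succ n ih => intro x w hw; rw [Function.iterate_succ_apply, Function.iterate_succ_apply, hG x w hw, ih _ w hw]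

lemma iter_mul {G : R2 → R2} (hG : ∀ x, ∀ w ∈ intLattice, G (x + w) = G x + w) {n : ℕ} {z w : R2}
    (hw : w ∈ intLattice) (h : G^[n] z = z + w) (k : ℕ) : G^[k * n] z = z + k • w := by
  induction k with
  | zero => simp
  | succ k ih =>
    rw [Nat.succ_mul, add_comm, Function.iterate_add_apply, ih,
      iter_equiv hG _ _ _ (intLattice.nsmul_mem hw k), h, succ_nsmul]; abel

lemma per_mem_rotSet (G : R2 ≃ₜ R2) (hG : ∀ x, ∀ w ∈ intLattice, G (x + w) = G x + w) {n : ℕ}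
    (hn : 1 ≤ n) {z w : R2} (hw : w ∈ intLattice) (h : (⇑G)^[n] z = z + w) :
    (n : ℝ)⁻¹ • w ∈ rotSet G := by
  rw [rotSet_iff]
  intro ε hε N
  refine ⟨(N + 1) * n, by nlinarith, z, ?_⟩
  rw [iter_mul hG hw h, add_sub_cancel_left, ← Nat.cast_smul_eq_nsmul ℝ, smul_smul]
  have : (((N + 1) * n : ℕ) : ℝ)⁻¹ * ((N + 1 : ℕ) : ℝ) = (n : ℝ)⁻¹ := by
    have : (n : ℝ) ≠ 0 := by positivity
    push_cast; field_simp
  rw [this]; simpa using hε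

lemma disp_bound (F : R2 ≃ₜ R2) (hF : ∀ x, ∀ w ∈ intLattice, F (x + w) = F x + w) :
    ∃ C, 0 ≤ C ∧ ∀ x, ‖F x - x‖ ≤ C := by
  obtain ⟨C, hC⟩ := (isCompact_closedBall (0 : R2) 1).exists_bound_of_continuousOn
    (f := fun x => F x - x) (by fun_prop)
  have key : ∀ x, ‖F x - x‖ ≤ C := by
    intro x
    have h1 : x - lat (rd x) ∈ closedBall (0 : R2) 1 := by
      rw [mem_closedBall_zero_iff, ← sq_le_sq₀ (norm_nonneg _) (by norm_num), normsq]
      simp only [PiLp.sub_apply, lat_apply, rd]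
      have h0 := sq_le_sq' (by linarith [neg_abs_le (x 0 - round (x 0)), abs_sub_round (x 0)]) ((le_abs_self _).trans (abs_sub_round (x 0)))
      have h1 := sq_le_sq' (by linarith [neg_abs_le (x 1 - round (x 1)), abs_sub_round (x 1)]) ((le_abs_self _).trans (abs_sub_round (x 1)))
      norm_num at h0 h1 ⊢
      linarith
    have h2 := hC _ h1
    have h3 := hF (x - lat (rd x)) _ (lat_mem (rd x))
    rw [sub_add_cancel] at h3
    rw [h3]
    have h4 : F (x - lat (rd x)) + lat (rd x) - x = F (x - lat (rd x)) - (x - lat (rd x)) := by abel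
    rw [h4]; exact h2
  exact ⟨C, (norm_nonneg _).trans (key 0), key⟩

/-- Composition with a small admissible map. -/
lemma stable_use {f : T2 ≃ₜ T2} (hf : f ∈ Homeo0Leb) {F : R2 ≃ₜ R2} (hF : IsLift f F) {δ : ℝ}
    (hst : UpperStable Homeo0Leb F δ) {H : R2 ≃ₜ R2} (hH : Adm H) {c : ℝ} (hc : c < δ)
    (hb : ∀ x, ‖H x - x‖ ≤ c) : rotSet (F.trans H) ⊆ rotSet F := by
  obtain ⟨h, h1, h2⟩ := hH
  have hl : IsLift (f.trans h) (F.trans H) := by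
    refine ⟨fun x => ?_, fun x w hw => ?_⟩
    · simp [h1.proj, hF.proj]
    · simp [hF.equivariant x w hw, h1.equivariant _ w hw]
  refine hst (f.trans h) ⟨⟨_, hl⟩, h2.comp hf.2⟩ _ hl (lt_of_le_of_lt ?_ hc)
  refine ciSup_le fun x => ?_
  rw [dist_comm, dist_eq_norm]
  exact hb _


/-- open grid cell -/
def cell (N : ℕ) (a : Fin 2 → ℤ) : Set R2 :=
  {x | ∀ i, (a i : ℝ) < N * x i ∧ N * x i < a i + 1}

lemma cell_open (N : ℕ) (a : Fin 2 → ℤ) : IsOpen (cell N a) := by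
  have : cell N a = ⋂ i, {x : R2 | (a i : ℝ) < N * x i ∧ N * x i < a i + 1} := by
    ext x; simp [cell]
  rw [this]
  refine isOpen_iInter_of_finite fun i => ?_
  exact (isOpen_lt (f := fun _ : R2 => (a i : ℝ)) (g := fun x : R2 => N * x i) (by fun_prop)
    (by fun_prop)).inter (isOpen_lt (f := fun x : R2 => N * x i) (g := fun _ : R2 => (a i : ℝ) + 1)
    (by fun_prop) (by fun_prop))

lemma cell_unique {N : ℕ} {a b : Fin 2 → ℤ} {x : R2} (ha : x ∈ cell N a) (hb : x ∈ cell N b) :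
    a = b := by
  ext i
  have h1 := ha i
  have h2 := hb i
  have h3 : (a i : ℝ) < b i + 1 := by linarith
  have h4 : (b i : ℝ) < a i + 1 := by linarith
  norm_cast at h3 h4
  omega

lemma cell_add {N : ℕ} {a : Fin 2 → ℤ} {x : R2} (k : Fin 2 → ℤ) :
    x + lat k ∈ cell N (a + (N : ℤ) • k) ↔ x ∈ cell N a := by
  unfold cell
  refine forall_congr' fun i => ?_
  simp only [PiLp.add_apply, lat_apply, Pi.add_apply, Pi.smul_apply, smul_eq_mul]
  push_cast
  constructor <;> rintro ⟨h1, h2⟩ <;> constructor <;> linarith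

lemma cell_dist {N : ℕ} (hN : 1 ≤ N) {a : Fin 2 → ℤ} {x y : R2} (hx : x ∈ cell N a) (hy : y ∈ cell N a) :
    ‖x - y‖ ≤ 2 / N := by
  have hN' : (0 : ℝ) < N := by positivity
  have key : ∀ i, (x i - y i) ^ 2 ≤ (1 / N) ^ 2 := by
    intro i
    have h1 := hx i
    have h2 := hy i
    apply sq_le_sq'
    · rw [neg_le, div_eq_mul_inv, one_mul, ← one_div, le_div_iff₀ hN']; linarith
    · rw [le_div_iff₀ hN']; linarith
  rw [← sq_le_sq₀ (norm_nonneg _) (by positivity), normsq]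
  have h0 := key 0
  have h1 := key 1
  simp only [PiLp.sub_apply]
  have : (2 / (N : ℝ)) ^ 2 = 4 * (1 / N) ^ 2 := by ring
  nlinarith [sq_nonneg (1 / (N : ℝ))]

lemma cell_lat {N : ℕ} (hN : 1 ≤ N) {a : Fin 2 → ℤ} {x : R2} {k : R2} (hk : k ∈ intLattice)
    (hx : x ∈ cell N a) (hy : x - k ∈ cell N a) : k = 0 := by
  obtain ⟨k, rfl⟩ := exists_lat hk
  have h1 := (cell_add (N := N) k).2 hy
  rw [sub_add_cancel] at h1
  have h2 := cell_unique hx h1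
  have h3 : k = 0 := by
    ext i
    have := congrFun h2 i
    simp at this
    rcases this with h | h
    · omega
    · simpa using h
  rw [h3]; ext i; simp

lemma cell_conn {N : ℕ} (hN : 1 ≤ N) (a : Fin 2 → ℤ) {S : Set R2} (hS : S.Countable) :
    IsPreconnected (cell N a \ S) := by
  have hN' : (0 : ℝ) < N := by positivity
  let φ : R2 → R2 := fun u => WithLp.toLp 2 (fun i => ((a i : ℝ) + Real.sigmoid (u i)) / N)
  have hφc : Continuous φ := by
    refine (PiLp.continuous_toLp 2 _).comp ?_
    refine continuous_pi fun i => ?_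
    have := continuous_sigmoid.comp (show Continuous fun u : R2 => u i by fun_prop)
    exact (continuous_const.add this).div_const _
  have hφi : Function.Injective φ := by
    intro u v h
    ext i
    have := congrArg (fun w : R2 => w i) h
    simp only [φ] at this
    rw [div_left_inj' hN'.ne', add_right_inj] at this
    exact Real.sigmoid_injective this
  have himg : cell N a \ S = φ '' (φ ⁻¹' S)ᶜ := by
    ext x
    constructor
    · rintro ⟨hx, hxS⟩
      have : ∀ i, ∃ t, Real.sigmoid t = N * x i - a i := by
        intro i
        have : N * x i - a i ∈ range Real.sigmoid := by
          rw [Real.range_sigmoid]; constructor <;> linarith [(hx i).1, (hx i).2]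
        exact this
      choose t ht using this
      have e : φ (WithLp.toLp 2 t) = x := by
        ext i
        simp only [φ, ht]
        field_simp; ring
      refine ⟨WithLp.toLp 2 t, ?_, e⟩
      simpa [e] using hxS
    · rintro ⟨u, hu, rfl⟩
      refine ⟨fun i => ?_, hu⟩
      simp only [φ]
      rw [mul_div_cancel₀ _ hN'.ne']
      constructor <;> linarith [Real.sigmoid_pos (u i), Real.sigmoid_lt_one (u i)]
  rw [himg]
  refine IsPreconnected.image ?_ _ hφc.continuousOn
  refine (Set.Countable.isConnected_compl_of_one_lt_rank ?_ (hS.preimage hφi)).isPreconnected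
  rw [← Module.finrank_eq_rank]; simp

lemma single_move {U : Set R2} (hU : IsOpen U) (hc : IsPreconnected U)
    (hd : ∀ x ∈ U, ∀ k ∈ intLattice, x - k ∈ U → k = 0) {y z : R2} (hy : y ∈ U) (hz : z ∈ U) :
    ∃ H : R2 ≃ₜ R2, Adm H ∧ H y = z ∧ (∀ x, (∀ k ∈ intLattice, x - k ∉ U) → H x = x) ∧
      ∀ x ∈ U, H x ∈ U := by
  refine hc.induction₂' (fun y z => ∃ H : R2 ≃ₜ R2, Adm H ∧ H y = z ∧
    (∀ x, (∀ k ∈ intLattice, x - k ∉ U) → H x = x) ∧ ∀ x ∈ U, H x ∈ U) ?_ ?_ hy hz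
  · intro x hx
    obtain ⟨ρ, hρ, hb⟩ := Metric.isOpen_iff.1 hU x hx
    set r := min ρ (1 / 2) with hr
    have hr0 : 0 < r := lt_min hρ (by norm_num)
    have hr1 : r ≤ 1 / 2 := min_le_right _ _
    have hr2 : r ≤ ρ := min_le_left _ _
    have : ball x (r / 2) ∈ 𝓝[U] x := nhdsWithin_le_nhds (ball_mem_nhds x (by linarith))
    filter_upwards [this] with y hy
    rw [mem_ball, dist_eq_norm] at hy
    set m : R2 := (1 / 2 : ℝ) • (x + y) with hm
    have hmm : m + m = x + y := by rw [hm, ← add_smul]; norm_num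
    have hxm : ‖m - x‖ < r / 4 := by
      have : m - x = (1 / 2 : ℝ) • (y - x) := by rw [hm]; module
      rw [this, norm_smul]; norm_num; linarith
    have hymx : m + m - y = x := by rw [hmm]; abel
    have hym : ‖y - m‖ < r / 2 := by
      have : y - m = m - x := by rw [sub_eq_sub_iff_add_eq_add, hmm]; abel
      rw [this]; linarith
    obtain ⟨H, h1, h2, h3, h4, h5, -⟩ := exists_swapH (R := r / 2) (by linarith) hym
    rw [hymx] at h2 h3
    have hsub : ∀ p, ‖p - m‖ < r / 2 → p ∈ U := by
      intro p hp
      apply hb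
      rw [mem_ball, dist_eq_norm]
      have : p - x = (p - m) + (m - x) := by abel
      rw [this]
      refine (norm_add_le _ _).trans_lt ?_
      linarith
    have hid : ∀ x, (∀ k ∈ intLattice, x - k ∉ U) → H x = x := by
      intro p hp
      apply h4
      intro k hk
      by_contra! hlt
      exact hp k hk (hsub _ hlt)
    have hin : ∀ x ∈ U, H x ∈ U := by
      intro p hp
      by_cases hc : ∀ k ∈ intLattice, r / 2 ≤ ‖p - k - m‖
      · rw [h4 p hc]; exact hp
      · push Not at hc
        obtain ⟨k, hk, hlt⟩ := hc
        have := hd p hp k hk (hsub _ hlt)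
        subst this
        rw [sub_zero] at hlt
        exact hsub _ (h5 _ hlt)
    exact ⟨⟨H, h1, h3, hid, hin⟩, ⟨H, h1, h2, hid, hin⟩⟩
  · rintro x y z hx hy hz ⟨H, h1, h2, h3, h4⟩ ⟨K, k1, k2, k3, k4⟩
    refine ⟨H.trans K, h1.trans k1, by simp [h2, k2], fun p hp => ?_, fun p hp => k4 _ (h4 _ hp)⟩
    simp [h3 p hp, k3 p hp]

/-- admissible and preserving grid cells -/
def CellGood (N : ℕ) (H : R2 ≃ₜ R2) : Prop :=
  Adm H ∧ (∀ b, ∀ x ∈ cell N b, H x ∈ cell N b) ∧ ∀ x, (∀ b, x ∉ cell N b) → H x = x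

lemma CellGood.bound {N : ℕ} (hN : 1 ≤ N) {H : R2 ≃ₜ R2} (h : CellGood N H) (x : R2) :
    ‖H x - x‖ ≤ 2 / N := by
  by_cases hx : ∃ b, x ∈ cell N b
  · obtain ⟨b, hb⟩ := hx
    exact cell_dist hN (h.2.1 b x hb) hb
  · push Not at hx
    rw [h.2.2 x hx]; simp; positivity

lemma cellGood_of {N : ℕ} {a : Fin 2 → ℤ} {U : Set R2} (hU : U ⊆ cell N a) {H : R2 ≃ₜ R2} (h : Adm H)
    (h3 : ∀ x, (∀ k ∈ intLattice, x - k ∉ U) → H x = x) (h4 : ∀ x ∈ U, H x ∈ U) : CellGood N H := by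
  have key : ∀ x, H x = x ∨ ∃ c, x ∈ cell N c ∧ H x ∈ cell N c := by
    intro x
    by_cases hx : ∀ k ∈ intLattice, x - k ∉ U
    · exact Or.inl (h3 x hx)
    · push Not at hx
      obtain ⟨k, hk, hxk⟩ := hx
      right
      have e := h.equiv (x - k) hk
      obtain ⟨k, rfl⟩ := exists_lat hk
      rw [sub_add_cancel] at e
      refine ⟨a + (N : ℤ) • k, ?_, ?_⟩
      · have := (cell_add (N := N) k).2 (hU hxk)
        rwa [sub_add_cancel] at this
      · rw [e]; exact (cell_add k).2 (hU (h4 _ hxk))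
  refine ⟨h, fun b x hx => ?_, fun x hx => ?_⟩
  · rcases key x with h | ⟨c, h1, h2⟩
    · rwa [h]
    · rwa [cell_unique hx h1]
  · rcases key x with h | ⟨c, h1, h2⟩
    · exact h
    · exact absurd h1 (hx c)

lemma CellGood.trans {N : ℕ} {H K : R2 ≃ₜ R2} (h : CellGood N H) (k : CellGood N K) :
    CellGood N (H.trans K) :=
  ⟨h.1.trans k.1, fun b x hx => k.2.1 b _ (h.2.1 b x hx), fun x hx => by
    simp [h.2.2 x hx, k.2.2 x hx]⟩

lemma lat_closed : IsClosed (intLattice : Set R2) := by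
  have : (intLattice : Set R2) = ⋂ i, (fun x : R2 => x i) ⁻¹' (range ((↑) : ℤ → ℝ)) := by
    ext x
    simp only [mem_iInter, mem_preimage, mem_range]
    exact forall_congr' fun i => exists_congr fun n => eq_comm
  rw [this]
  exact isClosed_iInter fun i => (Int.isClosedEmbedding_coe_real.isClosed_range).preimage (by fun_prop)

lemma orb_closed (z : ℕ → R2) (n : ℕ) : IsClosed {p : R2 | ∃ k < n, p - z k ∈ intLattice} := by
  have : {p : R2 | ∃ k < n, p - z k ∈ intLattice} =
      ⋃ k ∈ Finset.range n, (fun p : R2 => p - z k) ⁻¹' (intLattice : Set R2) := by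
    ext p; simp
  rw [this]
  exact isClosed_biUnion_finset fun k _ => lat_closed.preimage (by fun_prop)

lemma orb_countable (z : ℕ → R2) (n : ℕ) : {p : R2 | ∃ k < n, p - z k ∈ intLattice}.Countable := by
  have : {p : R2 | ∃ k < n, p - z k ∈ intLattice} ⊆
      ⋃ k, (fun w : R2 => w + z k) '' (intLattice : Set R2) := by
    rintro p ⟨k, _, hk⟩
    exact mem_iUnion.2 ⟨k, _, hk, by simp⟩
  refine Set.Countable.mono this (countable_iUnion fun k => Set.Countable.image ?_ _)
  exact (Set.countable_coe_iff).1 lat_countable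

lemma multi_move {N : ℕ} (hN : 1 ≤ N) (b : ℕ → Fin 2 → ℤ) (y z : ℕ → R2) (n : ℕ)
    (hy : ∀ k < n, y k ∈ cell N (b k)) (hz : ∀ k < n, z k ∈ cell N (b k))
    (hyd : ∀ i < n, ∀ j < i, y i - y j ∉ intLattice)
    (hzd : ∀ i < n, ∀ j < i, z i - z j ∉ intLattice) :
    ∃ H : R2 ≃ₜ R2, CellGood N H ∧ ∀ k < n, H (y k) = z k := by
  induction n with
  | zero => exact ⟨_, ⟨Adm.refl, fun _ _ h => h, fun _ _ => rfl⟩, by simp⟩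
  | succ n ih =>
    obtain ⟨H, hH, h1⟩ := ih (fun k hk => hy k (by omega)) (fun k hk => hz k (by omega))
      (fun i hi => hyd i (by omega)) (fun i hi => hzd i (by omega))
    set S := {p : R2 | ∃ k < n, p - z k ∈ intLattice} with hS
    have hyS : H (y n) ∉ S := by
      rintro ⟨k, hk, hl⟩
      rw [← h1 k hk] at hl
      apply hyd n (by omega) k hk
      have e := hH.1.equiv (y k) hl
      rw [add_sub_cancel] at e
      have := H.injective e
      rw [← this, add_sub_cancel_left]
      exact hl
    have hzS : z n ∉ S := by
      rintro ⟨k, hk, hl⟩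
      exact hzd n (by omega) k hk hl
    obtain ⟨K, k1, k2, k3, k4⟩ := single_move (U := cell N (b n) \ S)
      ((cell_open N _).sdiff (orb_closed z n)) (cell_conn hN _ (orb_countable z n))
      (fun x hx k hk hxk => cell_lat hN hk hx.1 hxk.1)
      ⟨hH.2.1 _ _ (hy n (by omega)), hyS⟩ ⟨hz n (by omega), hzS⟩
    refine ⟨H.trans K, hH.trans (cellGood_of sdiff_subset k1 k3 k4), fun k hk => ?_⟩
    rcases Nat.lt_succ_iff_lt_or_eq.1 hk with hk | rfl
    · simp only [Homeomorph.trans_apply, h1 k hk]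
      apply k3
      intro w hw hmem
      exact hmem.2 ⟨k, hk, by simpa using hw⟩
    · exact k2


/-- edge of the cell graph -/
def Ed (N : ℕ) (F : R2 ≃ₜ R2) (a b : Fin 2 → ℤ) : Prop := ∃ x ∈ cell N a, F x ∈ cell N b

/-- walks in the cell graph -/
def Reach (N : ℕ) (F : R2 ≃ₜ R2) (n : ℕ) (a b : Fin 2 → ℤ) : Prop :=
  ∃ p : ℕ → Fin 2 → ℤ, p 0 = a ∧ p n = b ∧ ∀ k < n, Ed N F (p k) (p (k + 1))

section
variable {N : ℕ} {F : R2 ≃ₜ R2}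

lemma Reach.refl (a : Fin 2 → ℤ) : Reach N F 0 a a := ⟨fun _ => a, rfl, rfl, by simp⟩

lemma Reach.add {n m : ℕ} {a b c : Fin 2 → ℤ} (h1 : Reach N F n a b) (h2 : Reach N F m b c) :
    Reach N F (n + m) a c := by
  obtain ⟨p, p0, pn, hp⟩ := h1
  obtain ⟨r, r0, rm, hr⟩ := h2
  refine ⟨fun k => if k ≤ n then p k else r (k - n), by simp [p0], ?_, ?_⟩
  · rcases Nat.eq_zero_or_pos m with rfl | hm
    · simp [pn, ← r0, ← rm]
    · simp [show ¬ (n + m ≤ n) by omega, rm]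
  · intro k hk
    rcases lt_trichotomy k n with h | h | h
    · simp only [show k ≤ n by omega, show k + 1 ≤ n by omega, if_true]; exact hp k h
    · subst h
      have := hr 0 (by omega)
      simp only [le_refl, if_true, show ¬ (k + 1 ≤ k) by omega, if_false, pn, ← r0]
      simpa using this
    · simp only [show ¬ (k ≤ n) by omega, show ¬ (k + 1 ≤ n) by omega, if_false]
      have := hr (k - n) (by omega)
      rwa [show k - n + 1 = k + 1 - n by omega] at this

lemma Ed.shift (hF : ∀ x, ∀ w ∈ intLattice, F (x + w) = F x + w) {a b : Fin 2 → ℤ} (h : Ed N F a b)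
    (k : Fin 2 → ℤ) : Ed N F (a + (N : ℤ) • k) (b + (N : ℤ) • k) := by
  obtain ⟨x, hx, hy⟩ := h
  exact ⟨x + lat k, (cell_add k).2 hx, by rw [hF x _ (lat_mem k)]; exact (cell_add k).2 hy⟩

lemma Reach.shift (hF : ∀ x, ∀ w ∈ intLattice, F (x + w) = F x + w) {n : ℕ} {a b : Fin 2 → ℤ}
    (h : Reach N F n a b) (k : Fin 2 → ℤ) : Reach N F n (a + (N : ℤ) • k) (b + (N : ℤ) • k) := by
  obtain ⟨p, p0, pn, hp⟩ := h
  exact ⟨fun i => p i + (N : ℤ) • k, by simp [p0], by simp [pn], fun i hi => (hp i hi).shift hF k⟩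

lemma Reach.sub {p : ℕ → Fin 2 → ℤ} {n i j : ℕ} (hp : ∀ k < n, Ed N F (p k) (p (k + 1)))
    (hij : i ≤ j) (hj : j ≤ n) : Reach N F (j - i) (p i) (p j) :=
  ⟨fun k => p (i + k), rfl, by simp [hij], fun k hk => hp (i + k) (by omega)⟩

lemma choose_distinct (O : ℕ → Set R2) (n : ℕ) (hO : ∀ k < n, IsOpen (O k)) (hne : ∀ k < n, (O k).Nonempty) :
    ∃ c : ℕ → R2, (∀ k < n, c k ∈ O k) ∧ ∀ i < n, ∀ j < i, c i - c j ∉ intLattice := by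
  induction n with
  | zero => exact ⟨fun _ => 0, by simp, by simp⟩
  | succ n ih =>
    obtain ⟨c, h1, h2⟩ := ih (fun k hk => hO k (by omega)) (fun k hk => hne k (by omega))
    have hd := Set.Countable.dense_compl ℝ (orb_countable c n)
    obtain ⟨p, hpO, hp⟩ := hd.inter_open_nonempty (O n) (hO n (by omega)) (hne n (by omega))
    refine ⟨Function.update c n p, fun k hk => ?_, fun i hi j hj => ?_⟩
    · rcases Nat.lt_succ_iff_lt_or_eq.1 hk with hk | rfl
      · rw [Function.update_of_ne (by omega)]; exact h1 k hk
      · simpa using hpO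
    · rw [Function.update_of_ne (show j ≠ n by omega)]
      rcases Nat.lt_succ_iff_lt_or_eq.1 hi with hk | rfl
      · rw [Function.update_of_ne (by omega)]; exact h2 i hk j hj
      · rw [Function.update_self]
        intro hmem
        exact hp ⟨j, hj, hmem⟩

lemma realize (hN : 1 ≤ N) (hF : ∀ x, ∀ w ∈ intLattice, F (x + w) = F x + w) {n : ℕ} (hn : 1 ≤ n)
    {a w : Fin 2 → ℤ} (h : Reach N F n a (a + (N : ℤ) • w)) :
    ∃ H, CellGood N H ∧ ∃ z, (⇑(F.trans H))^[n] z = z + lat w := by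
  obtain ⟨p, p0, pn, hp⟩ := h
  obtain ⟨c, hc, hcd⟩ := choose_distinct (fun k => cell N (p k) ∩ F ⁻¹' cell N (p (k + 1))) n
    (fun k _ => (cell_open _ _).inter ((cell_open _ _).preimage F.continuous))
    (fun k hk => by obtain ⟨x, h1, h2⟩ := hp k hk; exact ⟨x, h1, h2⟩)
  obtain ⟨H, hH, hm⟩ := multi_move hN (fun k => p (k + 1)) (fun k => F (c k))
    (fun k => if k + 1 < n then c (k + 1) else c 0 + lat w) n (fun k hk => (hc k hk).2)
    (fun k hk => by
      split_ifs with h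
      · exact (hc _ h).1
      · rw [show k + 1 = n by omega, pn, cell_add, ← p0]; exact (hc 0 (by omega)).1)
    (fun i hi j hj hmem => by
      have e := hF (c j) _ hmem
      rw [add_sub_cancel] at e
      have e := F.injective e
      apply hcd i hi j hj
      rw [← e, add_sub_cancel_left]; exact hmem)
    (fun i hi j hj hmem => by
      rw [if_pos (show j + 1 < n by omega)] at hmem
      split_ifs at hmem with h
      · exact hcd (i + 1) h (j + 1) (by omega) hmem
      · apply hcd (j + 1) (by omega) 0 (by omega)
        have := intLattice.sub_mem (lat_mem w) hmem
        convert this using 1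
        abel)
  refine ⟨H, hH, c 0, ?_⟩
  have key : ∀ k < n, (⇑(F.trans H))^[k] (c 0) = c k := by
    intro k
    induction k with
    | zero => intro _; rfl
    | succ k ih =>
      intro hk
      rw [Function.iterate_succ_apply', ih (by omega)]
      have := hm k (by omega)
      rw [if_pos hk] at this
      exact this
  obtain ⟨k, rfl⟩ : ∃ k, n = k + 1 := ⟨n - 1, by omega⟩
  rw [Function.iterate_succ_apply', key k (by omega)]
  have := hm k (by omega)
  rw [if_neg (by omega)] at this
  exact this

/-- union of the open cells -/
def offGrid (N : ℕ) : Set R2 := ⋃ a, cell N a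

lemma offGrid_open : IsOpen (offGrid N) := isOpen_iUnion fun a => cell_open N a

lemma offGrid_inv {x k : R2} (hk : k ∈ intLattice) (hx : x ∈ offGrid N) : x + k ∈ offGrid N := by
  obtain ⟨k, rfl⟩ := exists_lat hk
  obtain ⟨a, ha⟩ := mem_iUnion.1 hx
  exact mem_iUnion.2 ⟨_, (cell_add k).2 ha⟩

lemma offGrid_null (hN : 1 ≤ N) : volume (offGrid N)ᶜ = 0 := by
  have hN' : (0 : ℝ) < N := by positivity
  have hsub : (offGrid N)ᶜ ⊆ ⋃ (i : Fin 2), ⋃ (m : ℤ), {x : R2 | x i = (m : ℝ) / N} := by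
    intro x hx
    by_contra hcon
    apply hx
    simp only [mem_iUnion, not_exists] at hcon
    refine mem_iUnion.2 ⟨fun i => ⌊N * x i⌋, fun i => ⟨?_, Int.lt_floor_add_one _⟩⟩
    refine lt_of_le_of_ne (Int.floor_le _) fun h => hcon i ⌊N * x i⌋ ?_
    change x i = _
    rw [eq_div_iff hN'.ne', mul_comm]; exact h.symm
  refine measure_mono_null hsub ?_
  rw [measure_iUnion_null_iff]; intro i
  rw [measure_iUnion_null_iff]; intro m
  have : {x : R2 | x i = (m : ℝ) / N} = (@WithLp.ofLp 2 (Fin 2 → ℝ)) ⁻¹' {f : Fin 2 → ℝ | f i = (m : ℝ) / N} := rfl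
  rw [this, (PiLp.volume_preserving_ofLp (Fin 2)).measure_preimage]
  · exact Measure.pi_hyperplane _ i _
  · exact ((measurable_pi_apply i) (measurableSet_singleton _)).nullMeasurableSet

lemma gen_ae (hN : 1 ≤ N) {f : T2 ≃ₜ T2} (hf : MeasurePreserving f lebT2 lebT2) :
    ∀ᵐ t ∂lebT2, ∀ j : ℕ, (⇑f)^[j] t ∈ pr '' offGrid N := by
  have hA : IsOpen (pr '' offGrid N) := pr_open _ offGrid_open
  have h0 : ∀ᵐ t ∂lebT2, t ∈ pr '' offGrid N := by
    rw [ae_iff]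
    change lebT2 (pr '' offGrid N)ᶜ = 0
    rw [leb_apply 0 hA.measurableSet.compl]
    refine measure_mono_null ?_ (offGrid_null hN)
    rintro x ⟨h1, -⟩ h2
    exact h1 ⟨x, h2, rfl⟩
  rw [ae_all_iff]
  intro j
  exact (hf.iterate j).quasiMeasurePreserving.ae h0

lemma mem_offGrid_of {x : R2} (h : pr x ∈ pr '' offGrid N) : x ∈ offGrid N := by
  obtain ⟨y, hy, e⟩ := h
  obtain ⟨k, hk, rfl⟩ := pr_eq_iff.1 e
  exact offGrid_inv hk hy

lemma pr_iter {f : T2 ≃ₜ T2} (hF : IsLift f F) (j : ℕ) (x : R2) : pr ((⇑F)^[j] x) = (⇑f)^[j] (pr x) := by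
  induction j with
  | zero => rfl
  | succ j ih => rw [Function.iterate_succ_apply', Function.iterate_succ_apply', hF.proj, ih]

lemma orbit_reach {x : R2} (h : ∀ j : ℕ, (⇑F)^[j] x ∈ offGrid N) {n : ℕ} {a b : Fin 2 → ℤ}
    (ha : x ∈ cell N a) (hb : (⇑F)^[n] x ∈ cell N b) : Reach N F n a b := by
  choose p hp using fun j => mem_iUnion.1 (h j)
  refine ⟨p, cell_unique (hp 0) ha, cell_unique (hp n) hb, fun k _ => ⟨_, hp k, ?_⟩⟩
  have := hp (k + 1)
  rwa [Function.iterate_succ_apply'] at this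

lemma gen_dense (hN : 1 ≤ N) {f : T2 ≃ₜ T2} (hf : MeasurePreserving f lebT2 lebT2) (hF : IsLift f F)
    {O : Set R2} (hO : IsOpen O) (hne : O.Nonempty) : ∃ x ∈ O, ∀ j : ℕ, (⇑F)^[j] x ∈ offGrid N := by
  obtain ⟨t, ht, ht2⟩ := ((frequently_ae_mem_iff.2 (leb_pos hO hne)).and_eventually (gen_ae hN hf)).exists
  obtain ⟨x, hx, rfl⟩ := ht
  exact ⟨x, hx, fun j => mem_offGrid_of (by rw [pr_iter hF]; exact ht2 j)⟩

lemma Ed.rev (hN : 1 ≤ N) {f : T2 ≃ₜ T2} (hf : MeasurePreserving f lebT2 lebT2) (hF : IsLift f F)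
    {a b : Fin 2 → ℤ} (h : Ed N F a b) : ∃ m k, Reach N F m b (a + (N : ℤ) • k) := by
  have hO : IsOpen (cell N a ∩ F ⁻¹' cell N b) :=
    (cell_open _ _).inter ((cell_open _ _).preimage F.continuous)
  have hne : (cell N a ∩ F ⁻¹' cell N b).Nonempty := by
    obtain ⟨x, h1, h2⟩ := h; exact ⟨x, h1, h2⟩
  have hcons := hf.conservative.ae_mem_imp_frequently_image_mem
    (pr_open _ hO).measurableSet.nullMeasurableSet
  obtain ⟨t, ht, ht2, ht3⟩ := ((frequently_ae_mem_iff.2 (leb_pos hO hne)).and_eventually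
    ((gen_ae hN hf).and hcons)).exists
  have hfr := ht3 ht
  obtain ⟨x, hx, rfl⟩ := ht
  obtain ⟨n, hn, hn2⟩ := frequently_atTop.1 hfr 1
  have hx2 : ∀ j : ℕ, (⇑F)^[j] x ∈ offGrid N := fun j => mem_offGrid_of (by rw [pr_iter hF]; exact ht2 j)
  obtain ⟨y, hy, e⟩ := hn2
  rw [← pr_iter hF] at e
  obtain ⟨k, hk, e⟩ := pr_eq_iff.1 e
  obtain ⟨k, rfl⟩ := exists_lat hk
  refine ⟨n - 1, k, orbit_reach (x := F x) (fun j => ?_) hx.2 ?_⟩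
  · rw [← Function.iterate_succ_apply]; exact hx2 _
  · rw [← Function.iterate_succ_apply, show (n - 1).succ = n by omega, e]
    exact (cell_add k).2 hy.1

lemma Reach.rev (hN : 1 ≤ N) {f : T2 ≃ₜ T2} (hf : MeasurePreserving f lebT2 lebT2) (hF : IsLift f F)
    {n : ℕ} {a b : Fin 2 → ℤ} (h : Reach N F n a b) : ∃ m k, Reach N F m b (a + (N : ℤ) • k) := by
  obtain ⟨p, p0, pn, hp⟩ := h
  subst p0 pn
  induction n with
  | zero => exact ⟨0, 0, by simpa using Reach.refl _⟩
  | succ n ih =>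
    obtain ⟨m, k, h1⟩ := ih (fun i hi => hp i (by omega))
    obtain ⟨m', k', h2⟩ := (hp n (by omega)).rev hN hf hF
    refine ⟨m' + m, k + k', ?_⟩
    have h3 := h1.shift hF.equivariant k'
    rw [add_assoc, ← smul_add] at h3
    exact h2.add h3

end


/-- position of a cell -/
def pos (N : ℕ) (a : Fin 2 → ℤ) : R2 := (N : ℝ)⁻¹ • lat a

section
variable {N : ℕ} {F : R2 ≃ₜ R2}

lemma pos_add (a b : Fin 2 → ℤ) : pos N (a + b) = pos N a + pos N b := by
  unfold pos; rw [lat_add, smul_add]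

lemma pos_smul (hN : 1 ≤ N) (w : Fin 2 → ℤ) : pos N ((N : ℤ) • w) = lat w := by
  have : (N : ℝ) ≠ 0 := by positivity
  ext i; simp [pos]; field_simp

lemma pos_dist (hN : 1 ≤ N) {a : Fin 2 → ℤ} {x : R2} (hx : x ∈ cell N a) : ‖x - pos N a‖ ≤ 2 / N := by
  have hN' : (0 : ℝ) < N := by positivity
  have key : ∀ i, (x i - pos N a i) ^ 2 ≤ (1 / N) ^ 2 := by
    intro i
    have h1 := hx i
    have : x i - pos N a i = (N * x i - a i) / N := by simp [pos]; field_simp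
    rw [this]
    apply pow_le_pow_left₀
    · apply div_nonneg _ hN'.le; linarith
    · gcongr; linarith
  rw [← sq_le_sq₀ (norm_nonneg _) (by positivity), normsq]
  have h0 := key 0
  have h1 := key 1
  simp only [PiLp.sub_apply]
  have : (2 / (N : ℝ)) ^ 2 = 4 * (1 / N) ^ 2 := by ring
  nlinarith [sq_nonneg (1 / (N : ℝ))]

lemma reach_norm (hN : 1 ≤ N) {C : ℝ} (hC : ∀ x, ‖F x - x‖ ≤ C) {n : ℕ} {a b : Fin 2 → ℤ}
    (h : Reach N F n a b) : ‖pos N b - pos N a‖ ≤ n * (C + 4 / N) := by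
  obtain ⟨p, p0, pn, hp⟩ := h
  subst p0 pn
  induction n with
  | zero => simp
  | succ n ih =>
    have h1 := ih (fun i hi => hp i (by omega))
    obtain ⟨x, hx, hy⟩ := hp n (by omega)
    have e : pos N (p (n + 1)) - pos N (p 0) = (pos N (p n) - pos N (p 0)) + (x - pos N (p n))
      - (F x - pos N (p (n + 1))) + (F x - x) := by abel
    rw [e]
    have h2 := pos_dist hN hx
    have h3 := pos_dist hN hy
    have h4 := hC x
    have := norm_add_le (pos N (p n) - pos N (p 0) + (x - pos N (p n)) - (F x - pos N (p (n + 1)))) (F x - x)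
    have := norm_sub_le (pos N (p n) - pos N (p 0) + (x - pos N (p n))) (F x - pos N (p (n + 1)))
    have := norm_add_le (pos N (p n) - pos N (p 0)) (x - pos N (p n))
    push_cast
    have : 4 / (N : ℝ) = 2 / N + 2 / N := by ring
    linarith

/-- short loop ratios -/
def Sset (N : ℕ) (F : R2 ≃ₜ R2) (a : Fin 2 → ℤ) : Set R2 :=
  {s | ∃ l m : ℕ, ∃ b w : Fin 2 → ℤ, 1 ≤ l ∧ l ≤ N ^ 2 ∧ Reach N F m a b ∧
    Reach N F l b (b + (N : ℤ) • w) ∧ s = (l : ℝ)⁻¹ • lat w}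

/-- all loop ratios -/
def Dset (N : ℕ) (F : R2 ≃ₜ R2) (a : Fin 2 → ℤ) : Set R2 :=
  {s | ∃ n : ℕ, ∃ w : Fin 2 → ℤ, 1 ≤ n ∧ Reach N F n a (a + (N : ℤ) • w) ∧ s = (n : ℝ)⁻¹ • lat w}

lemma loop_disp (hN : 1 ≤ N) {C : ℝ} (hC : ∀ x, ‖F x - x‖ ≤ C) {n : ℕ} {a w : Fin 2 → ℤ}
    (h : Reach N F n a (a + (N : ℤ) • w)) : ‖lat w‖ ≤ n * (C + 4 / N) := by
  have := reach_norm hN hC h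
  rwa [pos_add, pos_smul hN, add_sub_cancel_left] at this

lemma Sset_finite (hN : 1 ≤ N) {C : ℝ} (hC0 : 0 ≤ C) (hC : ∀ x, ‖F x - x‖ ≤ C) (a : Fin 2 → ℤ) :
    (Sset N F a).Finite := by
  set R : ℝ := (N : ℝ) ^ 2 * (C + 4 / N) with hR
  let A : Finset (Fin 2 → ℤ) := Fintype.piFinset fun _ => Finset.Icc (-⌈R⌉) ⌈R⌉
  refine Set.Finite.subset (((Finset.range (N ^ 2 + 1)) ×ˢ A).finite_toSet.image
    (fun q => (q.1 : ℝ)⁻¹ • lat q.2)) ?_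
  rintro s ⟨l, m, b, w, h1, h2, -, h4, rfl⟩
  refine ⟨(l, w), ?_, rfl⟩
  have h5 := loop_disp hN hC h4
  have h6 : (l : ℝ) * (C + 4 / N) ≤ R := by
    rw [hR]; gcongr; exact_mod_cast h2
  simp only [Finset.coe_product, mem_prod, Finset.mem_coe, Finset.mem_range, A, Fintype.mem_piFinset,
    Finset.mem_Icc]
  refine ⟨by omega, fun i => ?_⟩
  have h7 := (abs_coord_le (lat w) i).trans (h5.trans (h6.trans (Int.le_ceil R)))
  rw [lat_apply] at h7
  rw [← abs_le]
  have h8 : ((|w i| : ℤ) : ℝ) ≤ ((⌈R⌉ : ℤ) : ℝ) := by rw [Int.cast_abs]; exact h7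
  exact Int.cast_le.1 h8

lemma pigeon (hN : 1 ≤ N) (p : ℕ → Fin 2 → ℤ) :
    ∃ i j, i < j ∧ j ≤ N ^ 2 ∧ ∃ w, p j = p i + (N : ℤ) • w := by
  have : NeZero N := ⟨by omega⟩
  obtain ⟨i, j, hij, he⟩ := Fintype.exists_ne_map_eq_of_card_lt
    (fun (k : Fin (N ^ 2 + 1)) (i : Fin 2) => ((p k i : ℤ) : ZMod N)) (by simp [ZMod.card])
  have key : ∀ i j : Fin (N ^ 2 + 1), i < j →
      ((fun t : Fin 2 => ((p i t : ℤ) : ZMod N)) = fun t => ((p j t : ℤ) : ZMod N)) →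
      ∃ i j, i < j ∧ j ≤ N ^ 2 ∧ ∃ w, p j = p i + (N : ℤ) • w := by
    intro i j hij he
    refine ⟨i, j, hij, by omega, ?_⟩
    have : ∀ t, ∃ w, p j t = p i t + N * w := by
      intro t
      obtain ⟨w, hw⟩ := (ZMod.intCast_eq_intCast_iff_dvd_sub _ _ _).1 (congrFun he t)
      exact ⟨w, by linarith⟩
    choose w hw using this
    exact ⟨w, by ext t; simp [hw]⟩
  rcases lt_or_gt_of_ne hij with h | h
  · exact key i j h he
  · exact key j i h he.symm

lemma walk_bound (hN : 1 ≤ N) (hF : ∀ x, ∀ w ∈ intLattice, F (x + w) = F x + w) {C : ℝ} (hC0 : 0 ≤ C)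
    (hC : ∀ x, ‖F x - x‖ ≤ C) (a : Fin 2 → ℤ) (ℓ : R2 →L[ℝ] ℝ) (α : ℝ)
    (hℓ : ∀ s ∈ Sset N F a, ℓ s ≤ α) :
    ∃ D, 0 ≤ D ∧ ∀ n b, Reach N F n a b → ℓ (pos N b - pos N a) ≤ α * n + D := by
  set D : ℝ := (N : ℝ) ^ 2 * (‖ℓ‖ * (C + 4 / N) + |α|) with hD
  refine ⟨D, by positivity, fun n => ?_⟩
  induction n using Nat.strong_induction_on with
  | _ n ih =>
  intro b h
  rcases le_or_gt n (N ^ 2) with hn | hn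
  · have h1 := reach_norm hN hC h
    have h2 := (le_abs_self _).trans (ℓ.le_opNorm (pos N b - pos N a))
    have h3 : ‖ℓ‖ * ‖pos N b - pos N a‖ ≤ ‖ℓ‖ * (n * (C + 4 / N)) := by gcongr
    have h4 : (n : ℝ) * (‖ℓ‖ * (C + 4 / N) + |α|) ≤ D := by
      rw [hD]; gcongr; exact_mod_cast hn
    have h5 : -α * n ≤ |α| * n := by gcongr; exact neg_le_abs α
    nlinarith
  · obtain ⟨p, p0, pn, hp⟩ := h
    obtain ⟨i, j, hij, hj, w, hw⟩ := pigeon hN p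
    have hs1 : Reach N F (j - i) (p i) (p i + (N : ℤ) • w) := by
      rw [← hw]; exact Reach.sub hp hij.le (by omega)
    have hs0 : Reach N F i a (p i) := by
      have := Reach.sub hp (Nat.zero_le i) (by omega)
      rwa [p0] at this
    have hs2 : Reach N F (n - j) (p i) (b + (N : ℤ) • (-w)) := by
      have := (Reach.sub hp (show j ≤ n by omega) le_rfl).shift hF (-w)
      rw [hw, pn] at this
      convert this using 1
      rw [smul_neg]; abel
    have h1 := ih (i + (n - j)) (by omega) _ (hs0.add hs2)
    have h2 := hℓ _ ⟨j - i, i, p i, w, by omega, by omega, hs0, hs1, rfl⟩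
    rw [pos_add, pos_smul hN, lat_neg] at h1
    have hl : (0 : ℝ) < ((j - i : ℕ) : ℝ) := by exact_mod_cast (by omega : 0 < j - i)
    rw [map_smul, smul_eq_mul, inv_mul_le_iff₀ hl] at h2
    have e : pos N b + -lat w - pos N a = (pos N b - pos N a) - lat w := by abel
    rw [e, map_sub] at h1
    have e2 : ((i + (n - j) : ℕ) : ℝ) = n - ((j - i : ℕ) : ℝ) := by
      rw [eq_sub_iff_add_eq]; norm_cast; omega
    rw [e2] at h1
    nlinarith

lemma far_of_not_hull (hN : 1 ≤ N) (hF : ∀ x, ∀ w ∈ intLattice, F (x + w) = F x + w) (a : Fin 2 → ℤ)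
    (v : R2) (hv : v ∉ convexHull ℝ (Sset N F a)) :
    ∀ᶠ k : ℕ in atTop, ∀ n ≥ k, ∀ b, Reach N F n a b →
      1 / ((k : ℝ) + 1) ≤ ‖(n : ℝ)⁻¹ • (pos N b - pos N a) - v‖ := by
  obtain ⟨C, hC0, hC⟩ := disp_bound F hF
  have hcl : IsClosed (convexHull ℝ (Sset N F a)) := (Sset_finite hN hC0 hC a).isClosed_convexHull (𝕜 := ℝ)
  obtain ⟨ℓ, α, h1, h2⟩ := geometric_hahn_banach_closed_point (convex_convexHull ℝ _) hcl hv
  obtain ⟨D, hD0, hD⟩ := walk_bound hN hF hC0 hC a ℓ α (fun s hs => (h1 s (subset_convexHull ℝ _ hs)).le)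
  have hlim : Tendsto (fun k : ℕ => (D + ‖ℓ‖) / (k : ℝ)) atTop (𝓝 0) :=
    tendsto_const_div_atTop_nhds_zero_nat _
  filter_upwards [hlim.eventually_lt_const (show 0 < ℓ v - α by linarith), eventually_ge_atTop 1] with k hk hk1
  intro n hn b hb
  by_contra! hlt
  have hk0 : (0 : ℝ) < k := by exact_mod_cast hk1
  have hn0 : (0 : ℝ) < n := by exact_mod_cast (by omega : 0 < n)
  have hnk : (k : ℝ) ≤ n := by exact_mod_cast hn
  have h3 := hD n b hb
  have h4 : ℓ ((n : ℝ)⁻¹ • (pos N b - pos N a)) ≤ α + D / n := by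
    rw [map_smul, smul_eq_mul, inv_mul_le_iff₀ hn0]
    have : (n : ℝ) * (α + D / n) = α * n + D := by field_simp
    linarith
  have h5 := (neg_le_abs _).trans (ℓ.le_opNorm ((n : ℝ)⁻¹ • (pos N b - pos N a) - v))
  rw [map_sub] at h5
  have h6 : ‖ℓ‖ * ‖(n : ℝ)⁻¹ • (pos N b - pos N a) - v‖ ≤ ‖ℓ‖ * (1 / k) := by
    gcongr
    refine hlt.le.trans ?_
    gcongr; linarith
  have h7 : D / n ≤ D / k := by gcongr
  have h8 : (D + ‖ℓ‖) / (k : ℝ) = D / k + ‖ℓ‖ * (1 / k) := by ring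
  linarith

lemma exists_hull (hN : 1 ≤ N) {f : T2 ≃ₜ T2} (hf : MeasurePreserving f lebT2 lebT2) (hF : IsLift f F)
    {v : R2} (hv : v ∈ rotSet F) : ∃ a, v ∈ convexHull ℝ (Sset N F a) := by
  by_contra! hcon
  have hN' : (0 : ℝ) < N := by positivity
  have hev := (Finset.eventually_all (Fintype.piFinset fun _ : Fin 2 => Finset.Ico (0 : ℤ) N)).2
    (fun a _ => far_of_not_hull hN hF.equivariant a v (hcon a))
  obtain ⟨k, hk⟩ := hev.exists
  obtain ⟨M, hM⟩ := exists_nat_gt ((4 / N) * (2 * ((k : ℝ) + 1)))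
  obtain ⟨n, hn, z0, hz0⟩ := (rotSet_iff F v).1 hv (1 / (2 * ((k : ℝ) + 1))) (by positivity) (max (max k 1) M)
  have hnk : k ≤ n := (le_max_left k 1).trans ((le_max_left _ _).trans hn)
  have hn1 : 1 ≤ n := (le_max_right k 1).trans ((le_max_left _ _).trans hn)
  have hnM : M ≤ n := (le_max_right _ _).trans hn
  obtain ⟨x, hx, hxg⟩ := gen_dense hN hf hF
    (O := {z | ‖(n : ℝ)⁻¹ • ((⇑F)^[n] z - z) - v‖ < 1 / (2 * ((k : ℝ) + 1))})
    (isOpen_lt (by have := F.continuous.iterate n; fun_prop) continuous_const) ⟨z0, hz0⟩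
  change ‖(n : ℝ)⁻¹ • ((⇑F)^[n] x - x) - v‖ < 1 / (2 * ((k : ℝ) + 1)) at hx
  obtain ⟨a0, ha0⟩ := mem_iUnion.1 (hxg 0)
  obtain ⟨b0, hb0⟩ := mem_iUnion.1 (hxg n)
  have hr := orbit_reach hxg ha0 hb0
  have hr2 := hr.shift hF.equivariant (fun i => - (a0 i / N))
  set a := a0 + (N : ℤ) • (fun i => - (a0 i / (N : ℤ))) with ha
  set b := b0 + (N : ℤ) • (fun i => - (a0 i / (N : ℤ))) with hb
  have haA : a ∈ Fintype.piFinset fun _ : Fin 2 => Finset.Ico (0 : ℤ) N := by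
    rw [Fintype.mem_piFinset]
    intro i
    have : a i = a0 i % N := by simp [ha, Int.emod_def]; ring
    rw [Finset.mem_Ico, this]
    exact ⟨Int.emod_nonneg _ (by omega), Int.emod_lt_of_pos _ (by omega)⟩
  have h1 := hk a haA n hnk b hr2
  have e : pos N b - pos N a = pos N b0 - pos N a0 := by
    rw [ha, hb, pos_add, pos_add]; abel
  rw [e] at h1
  have hn0 : (0 : ℝ) < n := by exact_mod_cast hn1
  have e2 : (n : ℝ)⁻¹ • (pos N b0 - pos N a0) - v = ((n : ℝ)⁻¹ • ((⇑F)^[n] x - x) - v) +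
      (n : ℝ)⁻¹ • ((x - pos N a0) - ((⇑F)^[n] x - pos N b0)) := by module
  have h2 : ‖(n : ℝ)⁻¹ • ((x - pos N a0) - ((⇑F)^[n] x - pos N b0))‖ ≤ (n : ℝ)⁻¹ * (4 / N) := by
    rw [norm_smul, norm_inv, Real.norm_natCast]
    gcongr
    refine (norm_sub_le _ _).trans ?_
    have h3 := pos_dist hN (show x ∈ cell N a0 from ha0)
    have h4 := pos_dist hN hb0
    have : 4 / (N : ℝ) = 2 / N + 2 / N := by ring
    linarith
  have h3 : (n : ℝ)⁻¹ * (4 / N) < 1 / (2 * ((k : ℝ) + 1)) := by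
    rw [inv_mul_lt_iff₀ hn0, mul_one_div, lt_div_iff₀ (by positivity)]
    refine hM.trans_le ?_
    exact_mod_cast hnM
  rw [e2] at h1
  have h4 := norm_add_le ((n : ℝ)⁻¹ • ((⇑F)^[n] x - x) - v)
    ((n : ℝ)⁻¹ • ((x - pos N a0) - ((⇑F)^[n] x - pos N b0)))
  have h5 : 1 / ((k : ℝ) + 1) = 1 / (2 * ((k : ℝ) + 1)) + 1 / (2 * ((k : ℝ) + 1)) := by field_simp; norm_num
  linarith

lemma Reach.mul (hF : ∀ x, ∀ w ∈ intLattice, F (x + w) = F x + w) {n : ℕ} {a w : Fin 2 → ℤ}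
    (h : Reach N F n a (a + (N : ℤ) • w)) (k : ℕ) :
    Reach N F (k * n) a (a + (N : ℤ) • ((k : ℤ) • w)) := by
  induction k with
  | zero => simpa using Reach.refl a
  | succ k ih =>
    have := ih.add (h.shift hF ((k : ℤ) • w))
    rw [Nat.succ_mul]
    convert this using 1
    push_cast
    module

lemma Dset_comb (hF : ∀ x, ∀ w ∈ intLattice, F (x + w) = F x + w) {a : Fin 2 → ℤ} {x y : R2}
    (hx : x ∈ Dset N F a) (hy : y ∈ Dset N F a) (i j : ℕ) (hij : 1 ≤ i + j) :
    ((i : ℝ) / ((i + j : ℕ) : ℝ)) • x + ((j : ℝ) / ((i + j : ℕ) : ℝ)) • y ∈ Dset N F a := by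
  obtain ⟨n, w, hn, h, rfl⟩ := hx
  obtain ⟨n', w', hn', h', rfl⟩ := hy
  refine ⟨(i * n') * n + (j * n) * n', ((i * n' : ℕ) : ℤ) • w + ((j * n : ℕ) : ℤ) • w', ?_, ?_, ?_⟩
  · rw [show (i * n') * n + (j * n) * n' = (i + j) * (n * n') by ring]
    exact Nat.mul_pos hij (Nat.mul_pos hn hn')
  · have h1 := h.mul hF (i * n')
    have h2 := (h'.mul hF (j * n)).shift hF (((i * n' : ℕ) : ℤ) • w)
    have := h1.add h2
    convert this using 1
    module
  · have e1 : (n : ℝ) ≠ 0 := by positivity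
    have e2 : (n' : ℝ) ≠ 0 := by positivity
    have e3 : (i : ℝ) + j ≠ 0 := by exact_mod_cast (by omega : i + j ≠ 0)
    ext t
    simp
    have e4 : (i : ℝ) * n' * n + j * n * n' ≠ 0 := by
      rw [show (i : ℝ) * n' * n + j * n * n' = (i + j) * (n * n') by ring]
      exact mul_ne_zero e3 (mul_ne_zero e1 e2)
    field_simp

lemma Dset_convex (hF : ∀ x, ∀ w ∈ intLattice, F (x + w) = F x + w) (a : Fin 2 → ℤ) :
    Convex ℝ (closure (Dset N F a)) := by
  intro x hx y hy s t hs ht hst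
  have key : ∀ x ∈ Dset N F a, ∀ y ∈ Dset N F a, s • x + t • y ∈ closure (Dset N F a) := by
    intro x hx y hy
    have h1 : Tendsto (fun k : ℕ => ((⌊s * (k : ℝ)⌋₊ : ℝ) / (k : ℝ))) atTop (𝓝 s) :=
      (tendsto_nat_floor_mul_div_atTop hs).comp tendsto_natCast_atTop_atTop
    have h2 : Tendsto (fun k : ℕ => ((⌊s * (k : ℝ)⌋₊ : ℝ) / (k : ℝ)) • x +
        (1 - ((⌊s * (k : ℝ)⌋₊ : ℝ) / (k : ℝ))) • y) atTop (𝓝 (s • x + (1 - s) • y)) :=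
      (h1.smul_const x).add ((tendsto_const_nhds.sub h1).smul_const y)
    rw [show t = 1 - s by linarith]
    refine mem_closure_of_tendsto h2 ?_
    filter_upwards [eventually_ge_atTop 1] with k hk
    have hfl : ⌊s * (k : ℝ)⌋₊ ≤ k := by
      apply Nat.floor_le_of_le
      have : (0 : ℝ) ≤ k := by positivity
      nlinarith
    have := Dset_comb hF hx hy ⌊s * (k : ℝ)⌋₊ (k - ⌊s * (k : ℝ)⌋₊) (by omega)
    rw [Nat.add_sub_cancel' hfl] at this
    convert this using 3
    have hk0 : (k : ℝ) ≠ 0 := by positivity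
    rw [Nat.cast_sub hfl, sub_div, div_self hk0]
  have := map_mem_closure₂ (f := fun x y : R2 => s • x + t • y) (by fun_prop) hx hy key
  rwa [closure_closure] at this

lemma Sset_sub (hN : 1 ≤ N) {f : T2 ≃ₜ T2} (hf : MeasurePreserving f lebT2 lebT2) (hF : IsLift f F)
    (a : Fin 2 → ℤ) : Sset N F a ⊆ closure (Dset N F a) := by
  rintro s ⟨l, m, b, w, hl, -, h1, h2, rfl⟩
  obtain ⟨m', k, h3⟩ := h1.rev hN hf hF
  have hl0 : (0 : ℝ) < l := by exact_mod_cast hl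
  have hlim : Tendsto (fun K : ℕ => ((l : ℝ) * (K * l + (m + m')))⁻¹) atTop (𝓝 0) := by
    apply Tendsto.inv_tendsto_atTop
    apply Tendsto.const_mul_atTop hl0
    exact tendsto_atTop_add_const_right _ _ (tendsto_natCast_atTop_atTop.atTop_mul_const hl0)
  have h4 : Tendsto (fun K : ℕ => (l : ℝ)⁻¹ • lat w + ((l : ℝ) * (K * l + (m + m')))⁻¹ •
      ((l : ℝ) • lat k - ((m : ℝ) + m') • lat w)) atTop (𝓝 ((l : ℝ)⁻¹ • lat w)) := by
    have := (tendsto_const_nhds (x := (l : ℝ)⁻¹ • lat w)).add (hlim.smul_const ((l : ℝ) • lat k - ((m : ℝ) + m') • lat w))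
    simpa using this
  refine mem_closure_of_tendsto h4 ?_
  filter_upwards [eventually_ge_atTop 1] with K hK
  refine ⟨m + (K * l + m'), (K : ℤ) • w + k, ?_, ?_, ?_⟩
  · have := Nat.mul_pos hK hl; omega
  · have h5 := h2.mul hF.equivariant K
    have h6 := h3.shift hF.equivariant ((K : ℤ) • w)
    have := h1.add (h5.add h6)
    convert this using 1
    module
  · have e2 : (K : ℝ) * l + (m + m') ≠ 0 := by
      have : (0 : ℝ) < K := by exact_mod_cast hK
      positivity
    have e3 : (m : ℝ) + (K * l + m') ≠ 0 := by
      have : (0 : ℝ) < K := by exact_mod_cast hK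
      positivity
    ext t
    simp
    field_simp
    ring

theorem stage1 {f : T2 ≃ₜ T2} (hf : f ∈ Homeo0Leb) (hF : IsLift f F) {δ : ℝ}
    (hst : UpperStable Homeo0Leb F δ) (hN : 1 ≤ N) (hNδ : 2 / (N : ℝ) < δ) {v : R2}
    (hv : v ∈ Set.extremePoints ℝ (rotSet F)) :
    ∃ H, CellGood N H ∧ ∃ n : ℕ, 1 ≤ n ∧ ∃ w z, (⇑(F.trans H))^[n] z = z + lat w ∧
      v = (n : ℝ)⁻¹ • lat w := by
  obtain ⟨a, ha⟩ := exists_hull hN hf.2 hF hv.1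
  have hD : closure (Dset N F a) ⊆ rotSet F := by
    apply closure_minimal _ (rotSet_closed F)
    rintro s ⟨n, w, hn, h, rfl⟩
    obtain ⟨H, hH, z, hz⟩ := realize hN hF.equivariant hn h
    refine stable_use hf hF hst hH.1 hNδ (fun x => hH.bound hN x) ?_
    refine per_mem_rotSet _ (fun x w hw => ?_) hn (lat_mem w) hz
    simp [hF.equivariant x w hw, hH.1.equiv _ hw]
  have hS : convexHull ℝ (Sset N F a) ⊆ rotSet F :=
    (convexHull_min (Sset_sub hN hf.2 hF a) (Dset_convex hF.equivariant a)).trans hD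
  have hext : v ∈ extremePoints ℝ (convexHull ℝ (Sset N F a)) :=
    inter_extremePoints_subset_extremePoints_of_subset hS ⟨ha, hv⟩
  obtain ⟨l, m, b, w, hl, -, h1, h2, e⟩ := extremePoints_convexHull_subset hext
  obtain ⟨H, hH, z, hz⟩ := realize hN hF.equivariant hl h2
  exact ⟨H, hH, l, hl, w, z, hz, e⟩

end


lemma balls (n : ℕ) (a : ℕ → R2) (ρ : ℕ → ℝ) (hρ : ∀ i < n, 0 ≤ ρ i)
    (h : ∀ i < n, ∀ j < n, ∀ k ∈ intLattice, (i ≠ j ∨ k ≠ 0) → ρ i + ρ j ≤ ‖a i - a j - k‖) :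
    ∑ i ∈ Finset.range n, Real.pi * ρ i ^ 2 ≤ 1 := by
  set S : Set R2 := ⋃ i ∈ Finset.range n, ball (a i) (ρ i) with hS
  have hvol : volume S = ENNReal.ofReal (∑ i ∈ Finset.range n, Real.pi * ρ i ^ 2) := by
    rw [hS, measure_biUnion_finset, ENNReal.ofReal_sum_of_nonneg (fun i _ => by positivity)]
    · refine Finset.sum_congr rfl fun i hi => ?_
      rw [EuclideanSpace.volume_ball_fin_two, ← ENNReal.ofReal_pow (hρ i (Finset.mem_range.1 hi)),
        mul_comm, ENNReal.ofReal_mul Real.pi_pos.le]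
    · intro i hi j hj hij
      simp only [Finset.coe_range, mem_Iio] at hi hj
      apply ball_disjoint_ball
      have := h i hi j hj 0 intLattice.zero_mem (Or.inl hij)
      rwa [sub_zero, ← dist_eq_norm] at this
    · intro i _; exact measurableSet_ball
  have hle : volume S ≤ 1 := by
    by_contra! hlt
    rw [← vol_box 0] at hlt
    obtain ⟨x, y, hxy, hd⟩ := exists_pair_mem_lattice_not_disjoint_vadd (box_fund 0)
      (Finset.measurableSet_biUnion _ (fun i _ => measurableSet_ball)).nullMeasurableSet hlt
    rw [Set.not_disjoint_iff] at hd
    obtain ⟨p, hp1, hp2⟩ := hd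
    obtain ⟨p1, hs1, e1⟩ := hp1
    obtain ⟨p2, hs2, e2⟩ := hp2
    simp only [hS, mem_iUnion, Finset.mem_range] at hs1 hs2
    obtain ⟨i, hi, hi2⟩ := hs1
    obtain ⟨j, hj, hj2⟩ := hs2
    rw [mem_ball, dist_eq_norm] at hi2 hj2
    have e1' : (x : R2) + p1 = p := e1
    have e2' : (y : R2) + p2 = p := e2
    have := h i hi j hj (y - x : R2) (intLattice.sub_mem y.2 x.2) (Or.inr fun h0 => hxy (by
      ext1; exact (sub_eq_zero.1 h0).symm))
    have e : a i - a j - (y - x : R2) = (p2 - a j) - (p1 - a i) := by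
      have : p2 = p - (y : R2) := by rw [← e2']; abel
      rw [this]
      have : p1 = p - (x : R2) := by rw [← e1']; abel
      rw [this]; abel
    rw [e] at this
    have := norm_sub_le (p2 - a j) (p1 - a i)
    linarith
  rw [hvol] at hle
  exact ENNReal.ofReal_le_one.1 hle

lemma closest_pair (x : ℕ → R2) (P : Finset (ℕ × ℕ)) (hP : P.Nonempty) :
    ∃ p ∈ P, ∃ k ∈ intLattice, ∀ p' ∈ P, ∀ k' ∈ intLattice,
      ‖x p.1 - x p.2 - k‖ ≤ ‖x p'.1 - x p'.2 - k'‖ := by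
  obtain ⟨p, hp, hmin⟩ := Finset.exists_min_image P
    (fun p => ‖x p.1 - x p.2 - lat (rd (x p.1 - x p.2))‖) hP
  exact ⟨p, hp, _, lat_mem _, fun p' hp' k' hk' => (hmin p' hp').trans (rd_closest _ hk')⟩

lemma geo (a y : R2) (r : ℝ) (hr0 : 0 ≤ r) (h : ‖a - y‖ = 2 * r) : ∃ p : R2,
    11 / 10 * r ≤ ‖p - a‖ ∧ 11 / 10 * r ≤ ‖p - y‖ ∧
    ∀ z : R2, 2 * r ≤ ‖z - a‖ → 2 * r ≤ ‖z - y‖ → 11 / 10 * r ≤ ‖p - z‖ := by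
  have hu : (a 0 - y 0) ^ 2 + (a 1 - y 1) ^ 2 = 4 * r ^ 2 := by
    have := normsq (a - y)
    rw [h] at this
    simp only [PiLp.sub_apply] at this
    rw [← this]; ring
  obtain ⟨p, p0, p1⟩ : ∃ p : R2, p 0 = (a 0 + y 0) / 2 - (a 1 - y 1) / 4 ∧
      p 1 = (a 1 + y 1) / 2 + (a 0 - y 0) / 4 :=
    ⟨WithLp.toLp 2 ![(a 0 + y 0) / 2 - (a 1 - y 1) / 4, (a 1 + y 1) / 2 + (a 0 - y 0) / 4],
      by simp, by simp⟩
  obtain ⟨m, m0, m1⟩ : ∃ m : R2, m 0 = (a 0 + y 0) / 2 ∧ m 1 = (a 1 + y 1) / 2 :=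
    ⟨WithLp.toLp 2 ![(a 0 + y 0) / 2, (a 1 + y 1) / 2], by simp, by simp⟩
  refine ⟨p, ?_, ?_, ?_⟩
  · rw [← sq_le_sq₀ (by positivity) (norm_nonneg _), normsq]
    simp only [PiLp.sub_apply, p0, p1]
    nlinarith [sq_nonneg r]
  · rw [← sq_le_sq₀ (by positivity) (norm_nonneg _), normsq]
    simp only [PiLp.sub_apply, p0, p1]
    nlinarith [sq_nonneg r]
  · intro z h1 h2
    have hpm : ‖p - m‖ = r / 2 := by
      rw [← sq_eq_sq₀ (norm_nonneg _) (by positivity), normsq]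
      simp only [PiLp.sub_apply, p0, p1, m0, m1]
      nlinarith
    have hzm : 17 / 10 * r ≤ ‖z - m‖ := by
      rw [← sq_le_sq₀ (by positivity) (norm_nonneg _), normsq]
      rw [← sq_le_sq₀ (by positivity) (norm_nonneg _), normsq] at h1 h2
      simp only [PiLp.sub_apply] at h1 h2 ⊢
      rw [m0, m1]
      nlinarith [sq_nonneg r]
    have : ‖z - m‖ ≤ ‖p - z‖ + ‖p - m‖ := by
      have : z - m = (p - m) - (p - z) := by abel
      rw [this]; linarith [norm_sub_le (p - m) (p - z)]
    linarith

set_option maxHeartbeats 1000000 in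
lemma gap (q : ℕ) (hq : 2 ≤ q) (x : ℕ → R2) : ∃ i < q, ∃ j < q, i ≠ j ∧ ∃ k ∈ intLattice,
    ‖x i - x j - k‖ ≤ 2 / Real.sqrt (Real.pi * (q + 1 / 100)) := by
  obtain ⟨⟨i, j⟩, hp, k, hk, hmin⟩ := closest_pair x
    ((Finset.range q ×ˢ Finset.range q).filter fun p => p.1 ≠ p.2)
    ⟨(0, 1), by simp; omega⟩
  simp only [Finset.mem_filter, Finset.mem_product, Finset.mem_range] at hp hmin
  obtain ⟨⟨hi, hj⟩, hij⟩ := hp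
  have hmin' : ∀ i' < q, ∀ j' < q, i' ≠ j' → ∀ k' ∈ intLattice,
      ‖x i - x j - k‖ ≤ ‖x i' - x j' - k'‖ := fun i' hi' j' hj' h k' hk' =>
    hmin (i', j') ⟨⟨hi', hj'⟩, h⟩ k' hk'
  refine ⟨i, hi, j, hj, hij, k, hk, ?_⟩
  set d := ‖x i - x j - k‖ with hd
  have hd0 : 0 ≤ d := norm_nonneg _
  have hd1 : d < 1 := by
    by_contra! hge
    have hb := balls 2 (fun t => if t = 0 then x i else x j) (fun _ => 1 / 2) (fun _ _ => by norm_num) (by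
      intro s hs t ht w hw hor
      have hcase : (1 : ℝ) ≤ ‖(if s = 0 then x i else x j) - (if t = 0 then x i else x j) - w‖ := by
        by_cases hst : s = t
        · subst hst
          rw [sub_self, zero_sub, norm_neg]
          exact one_le_norm_lat hw (by tauto)
        · interval_cases s <;> interval_cases t
          · exact absurd rfl hst
          · simpa using hge.trans (hmin' i hi j hj hij w hw)
          · simpa using hge.trans (hmin' j hj i hi hij.symm w hw)
          · exact absurd rfl hst
      linarith)
    simp at hb
    linarith [Real.pi_gt_three]
  set r := d / 2 with hr
  set y := x j + k with hy
  have hr0 : 0 ≤ r := by positivity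
  obtain ⟨p, hpi, hpy, hother'⟩ := geo (x i) y r hr0 (by
    rw [hr, show x i - y = x i - x j - k by rw [hy]; abel, ← hd]; ring)
  have h2r : 2 * r = d := by rw [hr]; ring
  rw [h2r] at hother'
  have hother := hother'
  clear_value d
  have hall : ∀ l < q, ∀ w ∈ intLattice, 11 / 10 * r ≤ ‖p - x l - w‖ := by
    intro l hl w hw
    rw [sub_sub]
    by_cases h1 : x l + w = x i
    · rw [h1]; exact hpi
    by_cases h2 : x l + w = y
    · rw [h2]; exact hpy
    apply hother
    · by_cases hli : l = i
      · subst hli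
        rw [add_sub_cancel_left]
        exact hd1.le.trans (one_le_norm_lat hw (by rintro rfl; simp at h1))
      · have := hmin' l hl i hi hli (-w) (intLattice.neg_mem hw)
        convert this using 2; abel
    · by_cases hlj : l = j
      · subst hlj
        rw [hy, add_sub_add_left_eq_sub]
        exact hd1.le.trans (one_le_norm_lat (intLattice.sub_mem hw hk) (by
          intro h0; apply h2; rw [hy, sub_eq_zero.1 h0]))
      · have := hmin' l hl j hj hlj (k - w) (intLattice.sub_mem hk hw)
        convert this using 2; rw [hy]; abel
  have hb := balls (q + 1) (fun t => if t = q then p else x t) (fun t => if t = q then r / 10 else r)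
    (fun t _ => by split_ifs <;> positivity) (by
      intro s hs t ht w hw hor
      by_cases hsq : s = q <;> by_cases htq : t = q
      · simp only [hsq, htq, if_true, sub_self, zero_sub, norm_neg]
        have := one_le_norm_lat hw (by rcases hor with h | h; exact absurd (hsq.trans htq.symm) h; exact h)
        linarith
      · simp only [hsq, htq, if_true, if_false]
        have := hall t (by omega) w hw
        linarith
      · simp only [hsq, htq, if_true, if_false]
        have := hall s (by omega) (-w) (intLattice.neg_mem hw)
        rw [← norm_neg] at this
        have e : -(p - x s - -w) = x s - p - w := by abel
        rw [e] at this
        linarith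
      · simp only [hsq, htq, if_false]
        by_cases hst : s = t
        · subst hst
          rw [sub_self, zero_sub, norm_neg]
          have := one_le_norm_lat hw (by tauto)
          linarith
        · have := hmin' s (by omega) t (by omega) hst w hw
          linarith)
  rw [Finset.sum_range_succ, Finset.sum_congr rfl (g := fun _ => Real.pi * r ^ 2) (fun t ht => by
    rw [if_neg (by rw [Finset.mem_range] at ht; omega)])] at hb
  simp only [if_true, Finset.sum_const, Finset.card_range, nsmul_eq_mul] at hb
  have hpos : 0 < Real.pi * ((q : ℝ) + 1 / 100) := by positivity
  rw [le_div_iff₀ (Real.sqrt_pos.2 hpos), ← sq_le_sq₀ (by positivity) (by norm_num), mul_pow,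
    Real.sq_sqrt hpos.le]
  have hd2 : d ^ 2 = 4 * r ^ 2 := by rw [hr]; ring
  rw [hd2]
  nlinarith


lemma qdvd (p₁ p₂ : ℤ) (q s : ℕ) (hq : 2 ≤ q) (hs : 1 ≤ s)
    (hgcd : Int.gcd p₁ (Int.gcd p₂ q) = 1) (v : R2) (hv0 : v 0 = (p₁ : ℝ) / (q : ℝ))
    (hv1 : v 1 = (p₂ : ℝ) / (q : ℝ)) (w : R2) (hw : w ∈ intLattice) (h : v = (s : ℝ)⁻¹ • w) :
    q ∣ s := by
  obtain ⟨a, rfl⟩ := exists_lat hw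
  have hq0 : (q : ℝ) ≠ 0 := by positivity
  have hs0 : (s : ℝ) ≠ 0 := by positivity
  have e0 : p₁ * (s : ℤ) = q * a 0 := by
    have : v 0 = (s : ℝ)⁻¹ * (a 0 : ℝ) := by rw [h]; simp
    rw [hv0] at this
    field_simp at this
    have h2 : ((p₁ * (s : ℤ) : ℤ) : ℝ) = ((q * a 0 : ℤ) : ℝ) := by push_cast; linarith
    exact_mod_cast h2
  have e1 : p₂ * (s : ℤ) = q * a 1 := by
    have : v 1 = (s : ℝ)⁻¹ * (a 1 : ℝ) := by rw [h]; simp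
    rw [hv1] at this
    field_simp at this
    have h2 : ((p₂ * (s : ℤ) : ℤ) : ℝ) = ((q * a 1 : ℤ) : ℝ) := by push_cast; linarith
    exact_mod_cast h2
  have b1 := Int.gcd_eq_gcd_ab p₂ q
  have b2 := Int.gcd_eq_gcd_ab p₁ (Int.gcd p₂ q)
  rw [hgcd] at b2
  set A := Int.gcdA p₂ q
  set B := Int.gcdB p₂ q
  set C := Int.gcdA p₁ (Int.gcd p₂ q)
  set D := Int.gcdB p₁ (Int.gcd p₂ q)
  rw [b1] at b2
  have : (q : ℤ) ∣ (s : ℤ) := by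
    refine ⟨a 0 * C + a 1 * A * D + s * B * D, ?_⟩
    push_cast at b2
    linear_combination (s : ℤ) * b2 + C * e0 + A * D * e1
  exact_mod_cast this

lemma follow (G H : R2 → R2) (x : ℕ → R2) (hx : ∀ k, G (x k) = x (k + 1)) (c : R2)
    (hc : c ∈ intLattice) (hG : ∀ x, ∀ w ∈ intLattice, G (x + w) = G x + w) (a s : ℕ)
    (hfix : ∀ t, 0 < t → t < s → H (x (a + t) + c) = x (a + t) + c) :
    ∀ t < s, (H ∘ G)^[t] (x a + c) = x (a + t) + c := by
  intro t
  induction t with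
  | zero => intro _; simp
  | succ t ih =>
    intro ht
    rw [Function.iterate_succ_apply', ih (by omega), Function.comp_apply, hG _ _ hc, hx]
    exact hfix (t + 1) (by omega) ht

lemma para (a y m p : R2) (hm : m + m = a + y) :
    ‖p - a‖ ^ 2 + ‖p - y‖ ^ 2 = 2 * ‖p - m‖ ^ 2 + ‖a - y‖ ^ 2 / 2 := by
  have h0 : m 0 + m 0 = a 0 + y 0 := congrArg (fun u : R2 => u 0) hm
  have h1 : m 1 + m 1 = a 1 + y 1 := congrArg (fun u : R2 => u 1) hm
  simp only [normsq, PiLp.sub_apply]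
  have e0 : m 0 = (a 0 + y 0) / 2 := by linarith
  have e1 : m 1 = (a 1 + y 1) / 2 := by linarith
  rw [e0, e1]; ring

lemma margin (n : ℕ) (x : ℕ → R2) (a y m : R2) (r R0 : ℝ) (hr : r < R0)
    (h : ∀ l < n, ∀ w ∈ intLattice, x l + w ≠ a → x l + w ≠ y → r < ‖x l + w - m‖) :
    ∃ R, r < R ∧ R ≤ R0 ∧
      ∀ l < n, ∀ w ∈ intLattice, x l + w ≠ a → x l + w ≠ y → R ≤ ‖x l + w - m‖ := by
  set S : Set R2 := ⋃ l ∈ Finset.range n, {p | p - x l ∈ intLattice ∧ p ≠ a ∧ p ≠ y} with hS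
  have hmem : ∀ p, p ∈ S ↔ ∃ l < n, p - x l ∈ intLattice ∧ p ≠ a ∧ p ≠ y := by
    intro p; simp only [hS, mem_iUnion, Finset.mem_range, mem_ofPred_eq, exists_prop]
  have hcl : IsClosed S := by
    refine isClosed_biUnion_finset fun l _ => ?_
    refine Metric.isClosed_of_pairwise_le_dist (ε := 1) one_pos ?_
    rintro p ⟨hp, -⟩ p' ⟨hp', -⟩ hne
    rw [dist_eq_norm]
    have := intLattice.sub_mem hp hp'
    rw [sub_sub_sub_cancel_right] at this
    exact one_le_norm_lat this (sub_ne_zero.2 hne)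
  rcases S.eq_empty_or_nonempty with he | hne
  · refine ⟨R0, hr, le_rfl, fun l hl w hw h1 h2 => ?_⟩
    have : x l + w ∈ S := (hmem _).2 ⟨l, hl, by rwa [add_sub_cancel_left], h1, h2⟩
    rw [he] at this; exact this.elim
  · obtain ⟨p, hp, hpe⟩ := hcl.exists_infDist_eq_dist hne m
    obtain ⟨l, hl, hpl, h1, h2⟩ := (hmem p).1 hp
    refine ⟨min R0 (infDist m S), lt_min hr ?_, min_le_left _ _, fun l hl w hw h1 h2 => ?_⟩
    · have := h l hl _ hpl (by rwa [add_sub_cancel]) (by rwa [add_sub_cancel])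
      rwa [hpe, dist_comm, dist_eq_norm, ← add_sub_cancel (x l) p]
    · refine (min_le_right _ _).trans ?_
      rw [← dist_eq_norm, dist_comm]
      exact infDist_le_dist_of_mem ((hmem _).2 ⟨l, hl, by rwa [add_sub_cancel_left], h1, h2⟩)

lemma per_class (G : R2 ≃ₜ R2) (hG : ∀ x, ∀ w ∈ intLattice, G (x + w) = G x + w) (n : ℕ)
    (z w0 : R2) (hw0 : w0 ∈ intLattice) (hn : 1 ≤ n) (hper : (⇑G)^[n] z = z + w0)
    (hmin : ∀ t, 1 ≤ t → (⇑G)^[t] z - z ∈ intLattice → n ≤ t) :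
    (∀ l, (⇑G)^[l] z - (⇑G)^[l % n] z ∈ intLattice) ∧
    (∀ i j, i ≤ j → (⇑G)^[j] z - (⇑G)^[i] z ∈ intLattice → n ∣ j - i) := by
  have h1 : ∀ l, (⇑G)^[l] z - (⇑G)^[l % n] z ∈ intLattice := by
    intro l
    have e : (⇑G)^[l] z = (⇑G)^[l % n] z + (l / n) • w0 := by
      conv_lhs => rw [← Nat.mod_add_div l n, mul_comm n, Function.iterate_add_apply,
        iter_mul hG hw0 hper, iter_equiv hG _ _ _ (intLattice.nsmul_mem hw0 _)]
    rw [e, add_sub_cancel_left]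
    exact intLattice.nsmul_mem hw0 _
  refine ⟨h1, fun i j hij h => ?_⟩
  obtain ⟨t, rfl⟩ := Nat.exists_eq_add_of_le hij
  rw [Nat.add_sub_cancel_left]
  have h2 : (⇑G)^[t] z - z ∈ intLattice := by
    have e : (⇑G)^[i] ((⇑G)^[t] z) = (⇑G)^[i] (z + ((⇑G)^[i + t] z - (⇑G)^[i] z)) := by
      rw [iter_equiv hG _ _ _ h, ← Function.iterate_add_apply]; abel
    have := G.injective.iterate i e
    rw [this, add_sub_cancel_left]; exact h
  have h3 : (⇑G)^[t % n] z - z ∈ intLattice := by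
    have := intLattice.sub_mem h2 (h1 t)
    rwa [sub_sub_sub_cancel_left] at this
  by_contra hnd
  have h4 : 1 ≤ t % n := Nat.pos_of_ne_zero fun h => hnd (Nat.dvd_of_mod_eq_zero h)
  have := hmin _ h4 h3
  have := Nat.mod_lt t hn
  omega


lemma min_pair (x : ℕ → R2) (q n : ℕ) (hq : 2 ≤ q) (hn : 1 ≤ n) (hqn : q ∣ n)
    (h1 : ∀ l, x l - x (l % n) ∈ intLattice) :
    ∃ i < n, ∃ j < n, i < j ∧ ¬ q ∣ (j - i) ∧ ∃ k ∈ intLattice,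
      ∀ i' j', i' % q ≠ j' % q → ∀ k' ∈ intLattice, ‖x i - x j - k‖ ≤ ‖x i' - x j' - k'‖ := by
  have hqn' := Nat.le_of_dvd hn hqn
  obtain ⟨⟨i, j⟩, hp, k, hk, hmin⟩ := closest_pair x
    ((Finset.range n ×ˢ Finset.range n).filter fun p => p.1 % q ≠ p.2 % q)
    ⟨(0, 1), by
      simp only [Finset.mem_filter, Finset.mem_product, Finset.mem_range]
      refine ⟨⟨by omega, by omega⟩, ?_⟩
      rw [Nat.zero_mod, Nat.mod_eq_of_lt (by omega)]; norm_num⟩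
  simp only [Finset.mem_filter, Finset.mem_product, Finset.mem_range] at hp hmin
  obtain ⟨⟨hi, hj⟩, hij⟩ := hp
  have hmin' : ∀ i' j', i' % q ≠ j' % q → ∀ k' ∈ intLattice,
      ‖x i - x j - k‖ ≤ ‖x i' - x j' - k'‖ := by
    intro i' j' h k' hk'
    have := hmin (i' % n, j' % n) ⟨⟨Nat.mod_lt _ hn, Nat.mod_lt _ hn⟩, by
      simpa only [Nat.mod_mod_of_dvd _ hqn] using h⟩
      (k' - (x i' - x (i' % n)) + (x j' - x (j' % n)))
      (intLattice.add_mem (intLattice.sub_mem hk' (h1 _)) (h1 _))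
    convert this using 2; simp only; abel
  rcases lt_trichotomy i j with h | h | h
  · refine ⟨i, hi, j, hj, h, fun hd => hij ?_, k, hk, hmin'⟩
    exact (Nat.modEq_iff_dvd' h.le).2 hd
  · exact absurd (by rw [h]) hij
  · refine ⟨j, hj, i, hi, h, fun hd => hij ?_, -k, intLattice.neg_mem hk, ?_⟩
    · exact ((Nat.modEq_iff_dvd' h.le).2 hd).symm
    · have e : x j - x i - -k = -(x i - x j - k) := by abel
      rw [e, norm_neg]; exact hmin'

lemma stage2 (G : R2 ≃ₜ R2) (hG : ∀ x, ∀ w ∈ intLattice, G (x + w) = G x + w) (q n : ℕ)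
    (hq : 2 ≤ q) (z w0 : R2) (hw0 : w0 ∈ intLattice) (hn : 1 ≤ n)
    (hper : (⇑G)^[n] z = z + w0)
    (hmin : ∀ t, 1 ≤ t → (⇑G)^[t] z - z ∈ intLattice → n ≤ t) (hqn : q ∣ n) (c : ℝ)
    (hc : 2 / Real.sqrt (Real.pi * (q + 1 / 100)) < c) (hc1 : c < 1) :
    ∃ H : R2 ≃ₜ R2, Adm H ∧ (∀ x, ‖H x - x‖ ≤ c) ∧ ∃ s, 0 < s ∧ s < n ∧ ¬ q ∣ s ∧
      ∃ k ∈ intLattice, (s : ℝ)⁻¹ • (-k) ∈ rotSet (G.trans H) ∧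
        ((n - s : ℕ) : ℝ)⁻¹ • (w0 + k) ∈ rotSet (G.trans H) := by
  obtain ⟨hcl1, hcl2⟩ := per_class G hG n z w0 hw0 hn hper hmin
  set x : ℕ → R2 := fun k => (⇑G)^[k] z with hx
  have hxs : ∀ k, G (x k) = x (k + 1) := fun k => (Function.iterate_succ_apply' _ _ _).symm
  have hcl1' : ∀ l, x l - x (l % n) ∈ intLattice := hcl1
  have hcl2' : ∀ i j, i ≤ j → x j - x i ∈ intLattice → n ∣ j - i := hcl2
  have hxn : ∀ i, x (i + n) = x i + w0 := by
    intro i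
    simp only [hx]
    rw [Function.iterate_add_apply, hper, iter_equiv hG _ _ _ hw0]
  clear_value x
  clear hcl1 hcl2
  obtain ⟨i, hi, j, hj, hij, hqs, k, hk, hd⟩ := min_pair x q n hq hn hqn hcl1'
  set d := ‖x i - x j - k‖ with hdd
  have hdc : d < c := by
    obtain ⟨a, ha, b, hb, hab, k', hk', hle⟩ := gap q hq x
    refine (hd a b ?_ k' hk').trans_lt (hle.trans_lt hc)
    rwa [Nat.mod_eq_of_lt ha, Nat.mod_eq_of_lt hb]
  have hijq : i % q ≠ j % q := fun h => hqs ((Nat.modEq_iff_dvd' hij.le).1 h)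
  obtain ⟨y, hy⟩ : ∃ y, y = x j + k := ⟨_, rfl⟩
  obtain ⟨m, hm⟩ : ∃ m : R2, m + m = x i + y := ⟨(1 / 2 : ℝ) • (x i + y), by
    rw [← add_smul]; norm_num⟩
  have hd0 : 0 ≤ d := norm_nonneg _
  have hdy : ‖x i - y‖ = d := by rw [hdd, hy]; congr 1; abel
  obtain ⟨R, hR, hRc, hfar⟩ := margin n x (x i) y m (d / 2) (c / 2) (by linarith) (by
    intro l hl w hw h1 h2
    by_contra! hle
    have hp := para (x i) y m (x l + w) hm
    have h1' : 0 < ‖x l + w - x i‖ := norm_pos_iff.2 (sub_ne_zero.2 h1)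
    have h2' : 0 < ‖x l + w - y‖ := norm_pos_iff.2 (sub_ne_zero.2 h2)
    rw [hdy] at hp
    have h3 : ‖x l + w - m‖ ^ 2 ≤ (d / 2) ^ 2 := by gcongr
    by_cases hli : l % q = i % q
    · have := hd l j (hli ▸ hijq) (k - w) (intLattice.sub_mem hk hw)
      have e : x l - x j - (k - w) = x l + w - y := by rw [hy]; abel
      rw [e] at this
      have : d ^ 2 ≤ ‖x l + w - y‖ ^ 2 := by gcongr
      nlinarith
    · have := hd l i hli (-w) (intLattice.neg_mem hw)
      have e : x l - x i - -w = x l + w - x i := by abel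
      rw [e] at this
      have : d ^ 2 ≤ ‖x l + w - x i‖ ^ 2 := by gcongr
      nlinarith)
  have hxm : ‖x i - m‖ < R := by
    have : x i - y = (2 : ℝ) • (x i - m) := by
      rw [smul_sub, two_smul, two_smul, hm]; abel
    rw [this, norm_smul] at hdy
    norm_num at hdy
    linarith
  obtain ⟨H, hH, hHa, hHb, hHfix, -, hHd⟩ := exists_swapH (by linarith) hxm
  have hmy : m + m - x i = y := by rw [hm]; abel
  rw [hmy] at hHa hHb
  have hfix : ∀ l, ¬ l ≡ i [MOD n] → ¬ l ≡ j [MOD n] → ∀ c ∈ intLattice,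
      H (x l + c) = x l + c := by
    intro l h1 h2 c hc
    apply hHfix
    intro k' hk'
    have key : ∀ b b', b ≤ b' → x b' - x b ∈ intLattice → b ≡ b' [MOD n] := fun b b' hb h =>
      (Nat.modEq_iff_dvd' hb).2 (hcl2' b b' hb h)
    have key2 : ∀ b b', x b' - x b ∈ intLattice → b ≡ b' [MOD n] := by
      intro b b' h
      rcases le_total b b' with hb | hb
      · exact key b b' hb h
      · exact (key b' b hb (by rw [← neg_sub]; exact intLattice.neg_mem h)).symm
    have e : x l + c - k' = x (l % n) + (x l - x (l % n) + c - k') := by abel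
    have hcw := intLattice.sub_mem (intLattice.add_mem (hcl1' l) hc) hk'
    have := hfar (l % n) (Nat.mod_lt _ hn) _ hcw (by
      rw [← e]; intro h
      refine h1 (key2 l i ?_)
      rw [← h]
      have : x l + c - k' - x l = c - k' := by abel
      rw [this]; exact intLattice.sub_mem hc hk') (by
      rw [← e]; intro h
      refine h2 (key2 l j ?_)
      have : x j - x l = c - k' - k := by
        rw [eq_sub_iff_add_eq.2 hy.symm, ← h]; abel
      rw [this]; exact intLattice.sub_mem (intLattice.sub_mem hc hk') hk)
    rwa [← e] at this
  have hHe : ∀ x, ∀ w ∈ intLattice, H (x + w) = H x + w := fun x w hw => hH.equiv x hw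
  have hGH : ∀ x, ∀ w ∈ intLattice, (G.trans H) (x + w) = (G.trans H) x + w := by
    intro x w hw
    simp only [Homeomorph.trans_apply]
    rw [hG _ _ hw, hHe _ _ hw]
  have hmodlt : ∀ a b, a < b → b < a + n → ¬ b ≡ a [MOD n] := by
    intro a b h1 h2 h
    have := Nat.le_of_dvd (by omega) ((Nat.modEq_iff_dvd' h1.le).1 h.symm)
    omega
  refine ⟨H, hH, fun x => (hHd x).trans (by linarith), j - i, by omega, by omega, hqs, k, hk, ?_, ?_⟩
  · refine per_mem_rotSet (G.trans H) hGH (z := x i) (by omega) (intLattice.neg_mem hk) ?_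
    have := follow G H x hxs 0 intLattice.zero_mem hG i (j - i) (fun t ht0 ht => by
      refine hfix _ (hmodlt _ _ (by omega) (by omega)) (fun h => hmodlt (i + t) j (by omega) (by omega) h.symm) _ intLattice.zero_mem)
      (j - i - 1) (by omega)
    rw [add_zero, add_zero] at this
    have e : j - i = (j - i - 1) + 1 := by omega
    rw [e, Function.iterate_succ_apply']
    have e2 : (⇑(G.trans H)) = H ∘ G := rfl
    rw [e2, this, Function.comp_apply, hxs, show i + (j - i - 1) + 1 = j by omega,
      show x j = y + -k by rw [hy]; abel, hHe _ _ (intLattice.neg_mem hk), hHb]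
  · refine per_mem_rotSet (G.trans H) hGH (z := y) (by omega) (intLattice.add_mem hw0 hk) ?_
    have := follow G H x hxs k hk hG j (n - (j - i)) (fun t ht0 ht => by
      refine hfix _ (fun h => hmodlt (j + t) (i + n) (by omega) (by omega) ?_)
        (hmodlt _ _ (by omega) (by omega)) _ hk
      exact (Nat.ModEq.trans h (Nat.ModEq.symm (by simp [Nat.ModEq]))).symm)
      (n - (j - i) - 1) (by omega)
    rw [← hy] at this
    have e : n - (j - i) = (n - (j - i) - 1) + 1 := by omega
    rw [e, Function.iterate_succ_apply']
    have e2 : (⇑(G.trans H)) = H ∘ G := rfl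
    rw [e2, this, Function.comp_apply, hG _ _ hk, hxs,
      show j + (n - (j - i) - 1) + 1 = i + n by omega, hxn, add_assoc,
      hHe _ _ (intLattice.add_mem hw0 hk), hHa]


lemma contra_stable (f : T2 ≃ₜ T2) (hf : f ∈ Homeo0Leb)
    (F : R2 ≃ₜ R2) (hF : IsLift f F) (p₁ p₂ : ℤ) (q : ℕ) (hq : 2 ≤ q)
    (hgcd : Int.gcd p₁ (Int.gcd p₂ q) = 1)
    (v : R2) (hv : v ∈ Set.extremePoints ℝ (rotSet F))
    (hv0 : v 0 = (p₁ : ℝ) / (q : ℝ)) (hv1 : v 1 = (p₂ : ℝ) / (q : ℝ))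
    (hst : UpperStable Homeo0Leb F (2 / Real.sqrt (Real.pi * (q : ℝ)))) : False := by
  have hqR : (2 : ℝ) ≤ q := by exact_mod_cast hq
  have hpi := Real.pi_gt_three
  obtain ⟨δ, hδ⟩ : ∃ δ, δ = 2 / Real.sqrt (Real.pi * (q : ℝ)) := ⟨_, rfl⟩
  obtain ⟨c, hc⟩ : ∃ c, c = 2 / Real.sqrt (Real.pi * (q + 1 / 100)) := ⟨_, rfl⟩
  rw [← hδ] at hst
  have hc0 : 0 < c := by rw [hc]; positivity
  have hcδ : c < δ := by
    rw [hc, hδ]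
    apply div_lt_div_of_pos_left (by norm_num) (by positivity)
    apply Real.sqrt_lt_sqrt (by positivity)
    nlinarith
  have hδ1 : δ < 1 := by
    rw [hδ, div_lt_one (by positivity)]
    apply Real.lt_sqrt_of_sq_lt
    nlinarith
  obtain ⟨N, hN⟩ := exists_nat_gt (4 / (δ - c))
  have hδc : 0 < δ - c := by linarith
  have hN0 : (0 : ℝ) < N := lt_trans (by positivity) hN
  have hN1 : 1 ≤ N := by exact_mod_cast hN0
  have hN2 : 2 / (N : ℝ) < (δ - c) / 2 := by
    rw [div_lt_iff₀ hδc] at hN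
    rw [div_lt_iff₀ hN0]; linarith
  obtain ⟨H0, hH0, n, hn, w, z, hz, hvw⟩ := stage1 hf hF hst hN1 (by linarith) hv
  have hG : ∀ x, ∀ w ∈ intLattice, (F.trans H0) (x + w) = (F.trans H0) x + w := by
    intro x w hw
    simp [hF.equivariant x w hw, hH0.1.equiv _ hw]
  have hex : ∃ t, 1 ≤ t ∧ (⇑(F.trans H0))^[t] z - z ∈ intLattice :=
    ⟨n, hn, by rw [hz, add_sub_cancel_left]; exact lat_mem w⟩
  classical
  obtain ⟨n0, ⟨hn0, hw0⟩, hmin⟩ : ∃ n0, (1 ≤ n0 ∧ (⇑(F.trans H0))^[n0] z - z ∈ intLattice) ∧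
      ∀ t, 1 ≤ t → (⇑(F.trans H0))^[t] z - z ∈ intLattice → n0 ≤ t :=
    ⟨Nat.find hex, Nat.find_spec hex, fun t h1 h2 => Nat.find_min' hex ⟨h1, h2⟩⟩
  obtain ⟨w0, hw0e⟩ : ∃ w0, w0 = (⇑(F.trans H0))^[n0] z - z := ⟨_, rfl⟩
  rw [← hw0e] at hw0
  have hper : (⇑(F.trans H0))^[n0] z = z + w0 := by rw [hw0e]; abel
  have hn0' : (n0 : ℝ) ≠ 0 := by positivity
  have hn' : (n : ℝ) ≠ 0 := by positivity
  have hv' : v = (n0 : ℝ)⁻¹ • w0 := by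
    have a1 := iter_mul hG hw0 hper n
    have a2 := iter_mul hG (lat_mem w) hz n0
    rw [mul_comm, a2] at a1
    have a3 := add_left_cancel a1
    rw [← Nat.cast_smul_eq_nsmul ℝ, ← Nat.cast_smul_eq_nsmul ℝ] at a3
    rw [hvw, inv_smul_eq_iff₀ hn', smul_comm, ← a3, inv_smul_smul₀ hn0']
  have hqn := qdvd p₁ p₂ q n0 hq hn0 hgcd v hv0 hv1 w0 hw0 hv'
  obtain ⟨H, hH, hHb, s, hs0, hsn, hqs, k, hk, hr1, hr2⟩ := stage2 (F.trans H0) hG q n0 hq z w0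
    hw0 hn0 hper hmin hqn ((δ + c) / 2) (by rw [← hc]; linarith) (by linarith)
  have hsub : rotSet ((F.trans H0).trans H) ⊆ rotSet F := by
    refine stable_use hf hF hst (H := H0.trans H) (hH0.1.trans hH)
      (c := 2 / N + (δ + c) / 2) (by linarith) (fun x => ?_)
    have e : (H0.trans H) x - x = (H0 x - x) + (H (H0 x) - H0 x) := by
      rw [Homeomorph.trans_apply]; abel
    rw [e]
    exact (norm_add_le _ _).trans (add_le_add (hH0.bound hN1 x) (hHb _))
  have hs' : (s : ℝ) ≠ 0 := by positivity
  have hns : (0 : ℝ) < ((n0 - s : ℕ) : ℝ) := by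
    have : 0 < n0 - s := by omega
    exact_mod_cast this
  have hcast : ((n0 - s : ℕ) : ℝ) = n0 - s := Nat.cast_sub hsn.le
  have hseg : v ∈ openSegment ℝ ((s : ℝ)⁻¹ • (-k)) (((n0 - s : ℕ) : ℝ)⁻¹ • (w0 + k)) := by
    refine ⟨(s : ℝ) / n0, ((n0 - s : ℕ) : ℝ) / n0, by positivity, by positivity, ?_, ?_⟩
    · rw [hcast]; field_simp; ring
    · rw [smul_smul, smul_smul, hv', div_mul_eq_mul_div, mul_inv_cancel₀ hs', div_mul_eq_mul_div,
        mul_inv_cancel₀ hns.ne', one_div, ← smul_add]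
      congr 1; abel
  have heq := hv.2 (hsub hr1) (hsub hr2) hseg
  exact hqs (qdvd p₁ p₂ q s hq hs0 hgcd v hv0 hv1 (-k) (intLattice.neg_mem hk) heq.symm)

/-- If `f ∈ Homeo_{0,λ}(T²)` and `ρ(F)` has an extremal point
`(p₁/q, p₂/q)` with `q > 1` and `gcd(p₁, p₂, q) = 1`, then the rotation set of `f` is
not `(2/√(πq))`-upper-stable in `Homeo_{0,λ}(T²)`. -/
theorem not_upper_stable_of_extreme_point_leb (f : T2 ≃ₜ T2) (hf : f ∈ Homeo0Leb)
    (F : R2 ≃ₜ R2) (hF : IsLift f F) (p₁ p₂ q : ℤ) (hq : 1 < q)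
    (hgcd : Int.gcd p₁ (Int.gcd p₂ q) = 1)
    (v : R2) (hv : v ∈ Set.extremePoints ℝ (rotSet F))
    (hv0 : v 0 = (p₁ : ℝ) / (q : ℝ)) (hv1 : v 1 = (p₂ : ℝ) / (q : ℝ)) :
    ∃ g ∈ Homeo0Leb, ∃ G : R2 ≃ₜ R2, IsLift g G ∧
      supDist (⇑F) (⇑G) < 2 / Real.sqrt (Real.pi * (q : ℝ)) ∧
      ¬ rotSet G ⊆ rotSet F := by
  by_contra hcon
  lift q to ℕ using by omega
  rw [Int.cast_natCast] at hv0 hv1 hcon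
  refine contra_stable f hf F hF p₁ p₂ q (by omega) hgcd v hv hv0 hv1 ?_
  intro g hg G hGl hd
  by_contra hnot
  exact hcon ⟨g, hg, G, hGl, hd, hnot⟩
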